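/- arXiv:1002.0190 — 6 statements merged into one kernel-verified Lean document; each statement's English description precedes it below -/
import Mathlib

section
/- In every k-blocked point set in the plane, at most three points are collinear; that is, no four points of a k-blocked set lie on a common line. -/
/-- `x` blocks `v` and `w` if `x` lies strictly between `v` and `w`. -/
def Blocks {E : Type*} [AddCommGroup E] [Module ℝ E] (x v w : E) : Prop :=
  x ∈ openSegment ℝ v w

/-- `v` and `w` are visible with respect to `P` if no point of `P` blocks them. -/
def Visible {E : Type*} [AddCommGroup E] [Module ℝ E] (P : Set E) (v w : E) : Prop :=
  ∀ x ∈ P, ¬ Blocks x v w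

/-- `c` is a blocked colouring of `P`: distinct points of `P` are visible
iff they get different colours. -/
def BlockedColouring {E : Type*} [AddCommGroup E] [Module ℝ E] {k : ℕ}
    (P : Set E) (c : E → Fin k) : Prop :=
  ∀ v ∈ P, ∀ w ∈ P, v ≠ w → (Visible P v w ↔ c v ≠ c w)

/-- `P` is `k`-blocked. -/
def KBlocked {E : Type*} [AddCommGroup E] [Module ℝ E] (k : ℕ) (P : Set E) : Prop :=
  P.Finite ∧ ∃ c : E → Fin k, BlockedColouring P c

/-- `P` is `{n₁,…,n_k}`-blocked where `N` is the multiset of colour class sizes. -/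
def IsNBlocked {E : Type*} [AddCommGroup E] [Module ℝ E] (N : Multiset ℕ) (P : Set E) : Prop :=
  P.Finite ∧ ∃ (k : ℕ) (c : E → Fin k), BlockedColouring P c ∧
    N = Finset.univ.val.map (fun i : Fin k => (P ∩ c ⁻¹' {i}).ncard)

/-- A multiset of positive integers is representable if some planar point set is
`N`-blocked. -/
def Representable (N : Multiset ℕ) : Prop :=
  ∃ P : Set (ℝ × ℝ), IsNBlocked N P

/-- A set is in convex position if no point lies in the convex hull of the others. -/
def ConvexPosition {E : Type*} [AddCommGroup E] [Module ℝ E] (K : Set E) : Prop :=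
  ∀ x ∈ K, x ∉ convexHull ℝ (K \ {x})

/-- `P` is `N`-midpoint-blocked: `N`-blocked, and midpoints of monochromatic pairs
belong to `P`. -/
def IsNMidpointBlocked {E : Type*} [AddCommGroup E] [Module ℝ E]
    (N : Multiset ℕ) (P : Set E) : Prop :=
  P.Finite ∧ ∃ (k : ℕ) (c : E → Fin k), BlockedColouring P c ∧
    (∀ v ∈ P, ∀ w ∈ P, v ≠ w → c v = c w → midpoint ℝ v w ∈ P) ∧
    N = Finset.univ.val.map (fun i : Fin k => (P ∩ c ⁻¹' {i}).ncard)

theorem AffineMap.blocks_iff_exists_mem_Ioo {E : Type*} [AddCommGroup E] [Module ℝ E]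
    (γ : ℝ →ᵃ[ℝ] E) {a b : ℝ} (hab : a < b) (x : E) :
    Blocks x (γ a) (γ b) ↔ ∃ t ∈ Set.Ioo a b, γ t = x := by
  rw [Blocks, ← image_openSegment, openSegment_eq_Ioo hab, Set.mem_image]

/-- Points on a line of a blocked set with a further point strictly between them share a colour. -/
theorem BlockedColouring.eq_of_lt_of_lt {E : Type*} [AddCommGroup E] [Module ℝ E] {k : ℕ}
    {P : Set E} {c : E → Fin k} (hc : BlockedColouring P c) {γ : ℝ →ᵃ[ℝ] E}
    (hγ : Function.Injective γ) {a b t : ℝ} (ha : γ a ∈ P) (hb : γ b ∈ P) (ht : γ t ∈ P)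
    (hat : a < t) (htb : t < b) : c (γ a) = c (γ b) := by
  by_contra hne
  exact (hc _ ha _ hb (hγ.ne (hat.trans htb).ne)).2 hne _ ht
    ((γ.blocks_iff_exists_mem_Ioo (hat.trans htb) _).2 ⟨t, ⟨hat, htb⟩, rfl⟩)

/-- A line meets a blocked set in at most three points. -/
theorem BlockedColouring.ncard_preimage_le_three {E : Type*} [AddCommGroup E] [Module ℝ E] {k : ℕ}
    {P : Set E} (hP : P.Finite) {c : E → Fin k} (hc : BlockedColouring P c) {γ : ℝ →ᵃ[ℝ] E}
    (hγ : Function.Injective γ) : (γ ⁻¹' P).ncard ≤ 3 := by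
  have hfin : (γ ⁻¹' P).Finite := hP.preimage hγ.injOn
  rw [Set.ncard_eq_toFinset_card _ hfin]
  by_contra! hcard
  let S := hfin.toFinset
  let f := S.orderEmbOfFin rfl
  have hmem (i : Fin S.card) : γ (f i) ∈ P :=
    hfin.mem_toFinset.1 (S.orderEmbOfFin_mem rfl i)
  have hlt {m n : ℕ} (hm : m < S.card) (hn : n < S.card) (h : m < n) :
      f ⟨m, hm⟩ < f ⟨n, hn⟩ := f.lt_iff_lt.2 h
  have h3 : 3 < S.card := hcard
  have h0 : 0 < S.card := by omega
  have h1 : 1 < S.card := by omega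
  have h2 : 2 < S.card := by omega
  have hvis : Visible P (γ (f ⟨0, h0⟩)) (γ (f ⟨1, h1⟩)) := by
    intro x hx hblock
    obtain ⟨t, ⟨h0t, ht1⟩, rfl⟩ :=
      (γ.blocks_iff_exists_mem_Ioo (hlt h0 h1 one_pos) x).1 hblock
    obtain ⟨i, rfl⟩ : t ∈ Set.range f := by
      rw [Finset.range_orderEmbOfFin]
      exact hfin.mem_toFinset.2 hx
    have hi0 : 0 < i.val := f.lt_iff_lt.1 h0t
    have hi1 : i.val < 1 := f.lt_iff_lt.1 ht1
    omega
  refine (hc _ (hmem _) _ (hmem _) (hγ.ne (hlt h0 h1 one_pos).ne)).1 hvis ?_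
  exact (hc.eq_of_lt_of_lt hγ (hmem _) (hmem _) (hmem _)
      (hlt h0 h1 (by norm_num)) (hlt h1 h3 (by norm_num))).trans
    (hc.eq_of_lt_of_lt hγ (hmem _) (hmem _) (hmem _)
      (hlt h1 h2 (by norm_num)) (hlt h2 h3 (by norm_num))).symm

/-- In every `k`-blocked point set, at most three points are collinear:
no four distinct points of the set lie on a common line. -/
theorem atMostThreeCollinear (k : ℕ) (P : Set (ℝ × ℝ)) (hP : KBlocked k P)
    (p q r s : ℝ × ℝ) (hp : p ∈ P) (hq : q ∈ P) (hr : r ∈ P) (hs : s ∈ P)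
    (hpq : p ≠ q) (hpr : p ≠ r) (hps : p ≠ s)
    (hqr : q ≠ r) (hqs : q ≠ s) (hrs : r ≠ s) :
    ¬ Collinear ℝ ({p, q, r, s} : Set (ℝ × ℝ)) := by
  obtain ⟨hfin, c, hc⟩ := hP
  intro hcol
  obtain ⟨v, hv⟩ := (collinear_iff_of_mem (p₀ := p) (by simp)).1 hcol
  have hv0 : v ≠ 0 := by
    rintro rfl
    obtain ⟨t, ht⟩ := hv q (by simp)
    exact hpq (by simpa using ht.symm)
  let γ : ℝ →ᵃ[ℝ] ℝ × ℝ := AffineMap.lineMap p (v +ᵥ p)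
  have hγ : Function.Injective γ := AffineMap.lineMap_injective ℝ (by simpa using hv0)
  have hrange : ({p, q, r, s} : Set (ℝ × ℝ)) ⊆ Set.range γ := by
    intro x hx
    obtain ⟨t, ht⟩ := hv x hx
    exact ⟨t, by simp [γ, AffineMap.lineMap_apply, ht]⟩
  have hsub : ({p, q, r, s} : Set (ℝ × ℝ)) ⊆ P := by
    simp [Set.insert_subset_iff, *]
  have hcard : (γ ⁻¹' {p, q, r, s}).ncard = 4 := by
    rw [Set.ncard_preimage_of_injective_subset_range hγ hrange]
    rw [Set.ncard_insert_of_notMem (by simp [*]), Set.ncard_insert_of_notMem (by simp [*]),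
      Set.ncard_pair hrs]
  have hle := Set.ncard_le_ncard (Set.preimage_mono (f := γ) hsub) (hfin.preimage hγ.injOn)
  have := hc.ncard_preimage_le_three hfin hγ
  omega
end

section
/- Each colour class of a k-blocked point set in the plane is in general position; that is, no three points belonging to the same colour class are collinear. -/
theorem blocks_iff_sbtw {E : Type*} [AddCommGroup E] [Module ℝ E] {x v w : E} (h : v ≠ w) :
    Blocks x v w ↔ Sbtw ℝ v x w := by
  rw [Blocks, openSegment_eq_image_lineMap, sbtw_iff_mem_image_Ioo_and_ne, and_iff_left h]

/-- If some point of a finite set `P` blocks `v` and `w`, then some blocker in `P` is visible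
from `v`. -/
theorem exists_sbtw_visible {E : Type*} [AddCommGroup E] [Module ℝ E] {P : Set E}
    (hfin : P.Finite) {v w : E} (h : ∃ x ∈ P, Sbtw ℝ v x w) :
    ∃ x ∈ P, Sbtw ℝ v x w ∧ Visible P v x := by
  obtain ⟨x, ⟨hxP, hx⟩, hmin⟩ := (hfin.sep (fun x => Sbtw ℝ v x w)).exists_minimalFor
    (fun x => {y ∈ P | Sbtw ℝ v y x}) _ h
  refine ⟨x, hxP, hx, fun y hyP hy => ?_⟩
  rw [blocks_iff_sbtw hx.left_ne] at hy
  have hsub : {z ∈ P | Sbtw ℝ v z x} ⊆ {z ∈ P | Sbtw ℝ v z y} :=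
    hmin ⟨hyP, hx.trans_left hy⟩ fun z hz => ⟨hz.1, hy.trans_left hz.2⟩
  exact (hsub ⟨hyP, hy⟩).2.ne_right rfl

/-- In a blocked colouring, a point lying strictly between two points of one colour class
does not belong to that class. -/
theorem BlockedColouring.not_sbtw {E : Type*} [AddCommGroup E] [Module ℝ E] {k : ℕ} {P : Set E}
    {c : E → Fin k} (hc : BlockedColouring P c) (hfin : P.Finite) {p q r : E}
    (hp : p ∈ P) (hq : q ∈ P) (hr : r ∈ P) (hpq : c p = c q) (hqr : c q = c r) :
    ¬ Sbtw ℝ p q r := by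
  intro h
  have hblocked : ∃ x ∈ P, Sbtw ℝ p x q := by
    by_contra! hnone
    refine (hc p hp q hq h.left_ne).1 (fun x hx hb => ?_) hpq
    exact hnone x hx ((blocks_iff_sbtw h.left_ne).1 hb)
  obtain ⟨x, hxP, hx, hvis⟩ := exists_sbtw_visible hfin hblocked
  have hxr : Sbtw ℝ x q r := h.trans_left_right hx
  have hpx : c p ≠ c x := (hc p hp x hxP hx.left_ne).1 hvis
  refine (hc x hxP r hr hxr.left_ne_right).2 (fun hcol => hpx ?_) q hq
    ((blocks_iff_sbtw hxr.left_ne_right).2 hxr)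
  rw [hpq, hqr, hcol]

/-- Each colour class of a `k`-blocked point set is in general position:
no three points of the same colour class are collinear. -/
theorem colourClassGeneralPosition (k : ℕ) (P : Set (ℝ × ℝ)) (hfin : P.Finite)
    (c : (ℝ × ℝ) → Fin k) (hc : BlockedColouring P c)
    (p q r : ℝ × ℝ) (hp : p ∈ P) (hq : q ∈ P) (hr : r ∈ P)
    (hpq : p ≠ q) (hpr : p ≠ r) (hqr : q ≠ r)
    (hcol : c p = c q ∧ c q = c r) :
    ¬ Collinear ℝ ({p, q, r} : Set (ℝ × ℝ)) := by
  intro h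
  obtain ⟨h₁, h₂⟩ := hcol
  rcases h.wbtw_or_wbtw_or_wbtw with hw | hw | hw
  · exact hc.not_sbtw hfin hp hq hr h₁ h₂ ⟨hw, hpq.symm, hqr⟩
  · exact hc.not_sbtw hfin hq hr hp h₂ (h₁.trans h₂).symm ⟨hw, hqr.symm, hpr.symm⟩
  · exact hc.not_sbtw hfin hr hp hq (h₁.trans h₂).symm h₁ ⟨hw, hpr, hpq⟩
end

section
/- The multisets {1,1,1}, {1,1,2}, {1,2,2} and {2,2,2} are the only representable multisets of size 3: a 3-blocked point set with colour classes of sizes n₁, n₂, n₃ exists if and only if {n₁,n₂,n₃} is one of these four multisets. -/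
theorem mem_openSegment_prod_iff (x p q : ℝ × ℝ) :
    x ∈ openSegment ℝ p q ↔
      ∃ t : ℝ, 0 < t ∧ t < 1 ∧ x = (p.1 + t * (q.1 - p.1), p.2 + t * (q.2 - p.2)) := by
  constructor
  · rintro ⟨a, b, ha, hb, hab, rfl⟩
    obtain rfl : a = 1 - b := by linarith
    refine ⟨b, hb, by linarith, ?_⟩
    ext <;> simp <;> ring
  · rintro ⟨t, h0, h1, rfl⟩
    refine ⟨1 - t, t, by linarith, h0, by ring, ?_⟩
    ext <;> simp <;> ring

/-- A point blocks two distinct points iff it is collinear with them and sees them in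
opposite directions. -/
theorem mem_openSegment_prod_iff_cross_dot (x p q : ℝ × ℝ) (hpq : p ≠ q) :
    x ∈ openSegment ℝ p q ↔
      (x.1 - p.1) * (x.2 - q.2) - (x.2 - p.2) * (x.1 - q.1) = 0 ∧
        (x.1 - p.1) * (x.1 - q.1) + (x.2 - p.2) * (x.2 - q.2) < 0 := by
  have hN : 0 < (q.1 - p.1) ^ 2 + (q.2 - p.2) ^ 2 := by
    by_contra! h
    refine hpq (Prod.ext ?_ ?_) <;>
      nlinarith [sq_nonneg (q.1 - p.1), sq_nonneg (q.2 - p.2)]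
  rw [mem_openSegment_prod_iff]
  constructor
  · rintro ⟨t, h0, h1, rfl⟩
    refine ⟨by ring, ?_⟩
    have := mul_pos (mul_pos h0 (sub_pos.2 h1)) hN
    dsimp only
    nlinarith
  · rintro ⟨hc, hd⟩
    set N := (q.1 - p.1) ^ 2 + (q.2 - p.2) ^ 2 with hNdef
    have hN0 : N ≠ 0 := hN.ne'
    refine ⟨((x.1 - p.1) * (q.1 - p.1) + (x.2 - p.2) * (q.2 - p.2)) / N,
      div_pos ?_ hN, (div_lt_one hN).2 ?_, Prod.ext ?_ ?_⟩
    · nlinarith [sq_nonneg (x.1 - p.1), sq_nonneg (x.2 - p.2)]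
    · rw [hNdef]
      nlinarith [sq_nonneg (x.1 - q.1), sq_nonneg (x.2 - q.2)]
    · dsimp only
      field_simp
      rw [hNdef]
      linear_combination -(q.2 - p.2) * hc
    · dsimp only
      field_simp
      rw [hNdef]
      linear_combination (q.1 - p.1) * hc

/-- Twice the signed area of the triangle `p q r`. -/
def signedArea (p q r : ℝ × ℝ) : ℝ :=
  (q.1 - p.1) * (r.2 - p.2) - (q.2 - p.2) * (r.1 - p.1)

namespace BlockedColouring

variable {k : ℕ} {P : Set (ℝ × ℝ)} {c : ℝ × ℝ → Fin k}

theorem exists_blocker (h : BlockedColouring P c) {p q : ℝ × ℝ} (hp : p ∈ P) (hq : q ∈ P)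
    (hpq : p ≠ q) (hc : c p = c q) : ∃ x ∈ P, x ∈ openSegment ℝ p q := by
  have : ¬ Visible P p q := fun hv => (h p hp q hq hpq).1 hv hc
  simpa [Visible, Blocks] using this

theorem colour_eq_of_blocks (h : BlockedColouring P c) {p q x : ℝ × ℝ} (hp : p ∈ P)
    (hq : q ∈ P) (hpq : p ≠ q) (hx : x ∈ P) (hb : x ∈ openSegment ℝ p q) : c p = c q := by
  by_contra hc
  exact (h p hp q hq hpq).2 hc x hx hb

/-- A point blocking two points of the same colour has another colour. -/
theorem colour_ne_of_blocks (h : BlockedColouring P c) (hP : P.Finite) {p q x : ℝ × ℝ}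
    (hp : p ∈ P) (hq : q ∈ P) (hpq : p ≠ q) (hc : c p = c q) (hx : x ∈ P)
    (hb : x ∈ openSegment ℝ p q) : c x ≠ c p := by
  intro hcx
  have hN : 0 < (q.1 - p.1) ^ 2 + (q.2 - p.2) ^ 2 := by
    by_contra! h
    refine hpq (Prod.ext ?_ ?_) <;>
      nlinarith [sq_nonneg (q.1 - p.1), sq_nonneg (q.2 - p.2)]
  let f : ℝ × ℝ → ℝ := fun y => (y.1 - p.1) * (q.1 - p.1) + (y.2 - p.2) * (q.2 - p.2)
  let S : Set (ℝ × ℝ) := {y | y ∈ P ∧ y ∈ openSegment ℝ p q ∧ c y = c p}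
  obtain ⟨y, ⟨hyP, hyb, hyc⟩, hmin⟩ :=
    Set.exists_min_image S f (hP.subset fun y hy => hy.1) ⟨x, hx, hb, hcx⟩
  obtain ⟨t, ht0, ht1, rfl⟩ := (mem_openSegment_prod_iff _ _ _).1 hyb
  set y : ℝ × ℝ := (p.1 + t * (q.1 - p.1), p.2 + t * (q.2 - p.2)) with hy
  have hfy : f y = t * ((q.1 - p.1) ^ 2 + (q.2 - p.2) ^ 2) := by simp only [f, hy]; ring
  have hpy : p ≠ y := by
    intro e
    have : f p = f y := congrArg f e
    rw [hfy] at this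
    simp only [f, sub_self, zero_mul, add_zero] at this
    exact (mul_pos ht0 hN).ne this
  obtain ⟨z, hzP, hzb⟩ := h.exists_blocker hp hyP hpy hyc.symm
  obtain ⟨s, hs0, hs1, rfl⟩ := (mem_openSegment_prod_iff _ _ _).1 hzb
  set z : ℝ × ℝ := (p.1 + s * (y.1 - p.1), p.2 + s * (y.2 - p.2)) with hz
  have hst : s * t < t := by nlinarith
  have hfz : f z = s * t * ((q.1 - p.1) ^ 2 + (q.2 - p.2) ^ 2) := by
    simp only [f, hz, hy]; ring
  have hlt : f z < f y := by
    rw [hfz, hfy]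
    exact mul_lt_mul_of_pos_right hst hN
  have hst1 : 0 < 1 - s * t := by linarith
  have hzq : z ≠ q := by
    intro e
    have e' : f z = f q := congrArg f e
    rw [hfz] at e'
    simp only [f] at e'
    nlinarith [mul_pos hst1 hN]
  have hyzq : y ∈ openSegment ℝ z q := by
    rw [mem_openSegment_prod_iff]
    have hw := div_mul_cancel₀ (t - s * t) hst1.ne'
    refine ⟨(t - s * t) / (1 - s * t), div_pos (by linarith) hst1,
      (div_lt_one hst1).2 (by linarith), Prod.ext ?_ ?_⟩ <;>
      simp only [hz, hy]
    · linear_combination (p.1 - q.1) * hw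
    · linear_combination (p.2 - q.2) * hw
  have hzc : c z = c p := (h.colour_eq_of_blocks hzP hq hzq hyP hyzq).trans hc.symm
  have hzpq : z ∈ openSegment ℝ p q := by
    rw [mem_openSegment_prod_iff]
    refine ⟨s * t, mul_pos hs0 ht0, by linarith, Prod.ext ?_ ?_⟩ <;>
    · simp only [hz, hy]
      ring
  exact absurd (hmin z ⟨hzP, hzpq, hzc⟩) hlt.not_ge

theorem exists_blocker_colour_ne (h : BlockedColouring P c) (hP : P.Finite) {p q : ℝ × ℝ}
    (hp : p ∈ P) (hq : q ∈ P) (hpq : p ≠ q) (hc : c p = c q) :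
    ∃ x ∈ P, x ∈ openSegment ℝ p q ∧ c x ≠ c p := by
  obtain ⟨x, hx, hb⟩ := h.exists_blocker hp hq hpq hc
  exact ⟨x, hx, hb, h.colour_ne_of_blocks hP hp hq hpq hc hx hb⟩

/-- Three distinct points of the same colour are not collinear. -/
theorem signedArea_ne_zero (h : BlockedColouring P c) (hP : P.Finite) {p q r : ℝ × ℝ}
    (hp : p ∈ P) (hq : q ∈ P) (hr : r ∈ P) (hpq : p ≠ q) (hpr : p ≠ r) (hqr : q ≠ r)
    (hcq : c p = c q) (hcr : c p = c r) : signedArea p q r ≠ 0 := by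
  intro hD
  obtain ⟨t, ht⟩ : ∃ t : ℝ, r = (p.1 + t * (q.1 - p.1), p.2 + t * (q.2 - p.2)) := by
    unfold signedArea at hD
    by_cases h1 : q.1 - p.1 = 0
    · have h2 : q.2 - p.2 ≠ 0 := fun h2 =>
        hpq (Prod.ext (by linarith) (by linarith))
      refine ⟨(r.2 - p.2) / (q.2 - p.2), Prod.ext ?_ ?_⟩
      · have : (q.2 - p.2) * (r.1 - p.1) = 0 := by rw [h1] at hD; linarith
        have := (mul_eq_zero.1 this).resolve_left h2
        simp only [h1]; linarith
      · simp only; field_simp; ring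
    · refine ⟨(r.1 - p.1) / (q.1 - p.1), Prod.ext ?_ ?_⟩
      · simp only; field_simp; ring
      · simp only; field_simp; linarith
  have ht0 : t ≠ 0 := by rintro rfl; apply hpr; rw [ht]; ext <;> simp
  have ht1 : t ≠ 1 := by rintro rfl; apply hqr; rw [ht]; ext <;> simp
  rcases lt_or_gt_of_ne ht0 with hneg | hpos
  · refine h.colour_ne_of_blocks hP hq hr hqr (hcq.symm.trans hcr) hp ?_ hcq
    rw [mem_openSegment_prod_iff]
    have : 0 < 1 - t := by linarith
    refine ⟨1 / (1 - t), by positivity, (div_lt_one this).2 (by linarith), Prod.ext ?_ ?_⟩ <;>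
    · rw [ht]; simp only; field_simp; ring
  · rcases lt_or_gt_of_ne ht1 with hlt | hgt
    · refine h.colour_ne_of_blocks hP hp hq hpq hcq hr ?_ hcr.symm
      exact (mem_openSegment_prod_iff _ _ _).2 ⟨t, hpos, hlt, ht⟩
    · refine h.colour_ne_of_blocks hP hp hr hpr hcr hq ?_ hcq.symm
      rw [mem_openSegment_prod_iff]
      refine ⟨1 / t, by positivity, (div_lt_one hpos).2 hgt, Prod.ext ?_ ?_⟩ <;>
      · rw [ht]; simp only; field_simp; ring

/-- In a smallest monochromatic triangle, the blockers on two sides cannot share a colour. -/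
theorem false_of_minimal_triangle {c : ℝ × ℝ → Fin 3} (h : BlockedColouring P c)
    (hP : P.Finite) {a₁ a₂ a₃ p q r : ℝ × ℝ} (h₂ : a₂ ∈ P) (h₃ : a₃ ∈ P)
    (hc₂ : c a₁ = c a₂) (hc₃ : c a₁ = c a₃) (hD : signedArea a₁ a₂ a₃ ≠ 0)
    (hmin : ∀ x ∈ P, ∀ y ∈ P, ∀ z ∈ P, c x = c y → c x = c z → signedArea x y z ≠ 0 →
      |signedArea a₁ a₂ a₃| ≤ |signedArea x y z|)
    (hp : p ∈ P) (hq : q ∈ P) (hr : r ∈ P) (hpb : p ∈ openSegment ℝ a₁ a₂)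
    (hqb : q ∈ openSegment ℝ a₁ a₃) (hrb : r ∈ openSegment ℝ a₂ a₃)
    (hpc : c p ≠ c a₁) (hrc : c r ≠ c a₁) (hpq : c p = c q) : False := by
  have small : ∀ x ∈ P, ∀ y ∈ P, ∀ z ∈ P, c x = c y → c x = c z → ∀ κ : ℝ, 0 < κ → κ < 1 →
      signedArea x y z = κ * signedArea a₁ a₂ a₃ → False := by
    intro x hx y hy z hz hxy hxz κ h0 h1 he
    have := hmin x hx y hy z hz hxy hxz (by rw [he]; exact mul_ne_zero h0.ne' hD)
    rw [he, abs_mul, abs_of_pos h0] at this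
    nlinarith [abs_pos.2 hD]
  obtain ⟨s, hs0, hs1, hps⟩ := (mem_openSegment_prod_iff _ _ _).1 hpb
  obtain ⟨t, ht0, ht1, hqt⟩ := (mem_openSegment_prod_iff _ _ _).1 hqb
  obtain ⟨u, hu0, hu1, hru⟩ := (mem_openSegment_prod_iff _ _ _).1 hrb
  have hs' : 0 < 1 - s := by linarith
  have ht' : 0 < 1 - t := by linarith
  have hu' : 0 < 1 - u := by linarith
  obtain ⟨K, hK⟩ : ∃ K : ℝ, K = (1 - s) * t * (1 - u) + s * (1 - t) * u := ⟨_, rfl⟩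
  have hK0 : 0 < K := by rw [hK]; positivity
  have hK1 : K < 1 := by
    have e1 : (1 - s) * t < 1 := by nlinarith
    have e2 : s * (1 - t) < 1 := by nlinarith
    rw [hK]
    nlinarith [mul_lt_mul_of_pos_right e1 hu', mul_lt_mul_of_pos_right e2 hu0]
  have hKD : signedArea q p r = K * signedArea a₁ a₂ a₃ := by
    rw [hps, hqt, hru, hK]; simp only [signedArea]; ring
  have hKD0 : signedArea q p r ≠ 0 := by rw [hKD]; exact mul_ne_zero hK0.ne' hD
  have hpr : c p ≠ c r := fun e => small q hq p hp r hr hpq.symm (hpq.symm.trans e) K hK0 hK1 hKD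
  have hpq' : p ≠ q := by
    rintro rfl
    exact hKD0 (by simp only [signedArea]; ring)
  obtain ⟨x, hx, hxb, hxc⟩ := h.exists_blocker_colour_ne hP hp hq hpq' hpq
  obtain ⟨v, hv0, hv1, hxv⟩ := (mem_openSegment_prod_iff _ _ _).1 hxb
  have hv' : 0 < 1 - v := by linarith
  obtain ⟨L, hL⟩ : ∃ L : ℝ, L = (1 - v) * (1 - s) + v * (1 - t) := ⟨_, rfl⟩
  have hL0 : 0 < L := by rw [hL]; positivity
  have hL1 : L < 1 := by rw [hL]; nlinarith [mul_pos hv' hs0, mul_pos hv0 ht0]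
  have hxa : c x ≠ c a₁ := fun e => by
    refine small x hx a₂ h₂ a₃ h₃ (e.trans hc₂) (e.trans hc₃) L hL0 hL1 ?_
    rw [hxv, hps, hqt, hL]; simp only [signedArea]; ring
  have hxr : c x = c r := by omega
  have hxr' : x ≠ r := by
    intro e
    apply hKD0
    rw [← e, hxv]; simp only [signedArea]; ring
  obtain ⟨y, hy, hyb, hyc⟩ := h.exists_blocker_colour_ne hP hx hr hxr' hxr
  obtain ⟨w, hw0, hw1, hyw⟩ := (mem_openSegment_prod_iff _ _ _).1 hyb
  have hw' : 0 < 1 - w := by linarith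
  have hya : c y ≠ c a₁ := fun e => by
    refine small y hy a₂ h₂ a₃ h₃ (e.trans hc₂) (e.trans hc₃) ((1 - w) * L) (by positivity)
      (by nlinarith) ?_
    rw [hyw, hxv, hps, hqt, hru, hL]; simp only [signedArea]; ring
  have hyp : c y = c p := by omega
  refine small q hq p hp y hy hpq.symm (hpq.symm.trans hyp.symm) (w * K) (by positivity)
    (by nlinarith) ?_
  rw [mul_assoc, ← hKD, hyw, hxv]; simp only [signedArea]; ring

/-- In a `3`-blocked point set, every colour class has at most two points. -/
theorem ncard_le_two {c : ℝ × ℝ → Fin 3} (h : BlockedColouring P c) (hP : P.Finite)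
    (i : Fin 3) : (P ∩ c ⁻¹' {i}).ncard ≤ 2 := by
  by_contra! hcard
  obtain ⟨a, b, d, ha, hb, hd, hab, had, hbd⟩ :=
    (Set.two_lt_ncard_iff (hP.subset Set.inter_subset_left)).1 hcard
  let S : Set ((ℝ × ℝ) × (ℝ × ℝ) × (ℝ × ℝ)) :=
    {T | (T.1 ∈ P ∧ T.2.1 ∈ P ∧ T.2.2 ∈ P) ∧ c T.1 = c T.2.1 ∧ c T.1 = c T.2.2 ∧
      signedArea T.1 T.2.1 T.2.2 ≠ 0}
  have hS : S.Finite := (hP.prod (hP.prod hP)).subset fun T hT => hT.1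
  have hcab : c a = c b := ha.2.trans hb.2.symm
  have hcad : c a = c d := ha.2.trans hd.2.symm
  obtain ⟨⟨a₁, a₂, a₃⟩, ⟨⟨h₁, h₂, h₃⟩, hc₂, hc₃, hD⟩, hmin⟩ :=
    Set.exists_min_image S (fun T => |signedArea T.1 T.2.1 T.2.2|) hS
      ⟨(a, b, d), ⟨ha.1, hb.1, hd.1⟩, hcab, hcad,
        h.signedArea_ne_zero hP ha.1 hb.1 hd.1 hab had hbd hcab hcad⟩
  dsimp only at h₁ h₂ h₃ hc₂ hc₃ hD hmin
  replace hmin : ∀ x ∈ P, ∀ y ∈ P, ∀ z ∈ P, c x = c y → c x = c z → signedArea x y z ≠ 0 →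
      |signedArea a₁ a₂ a₃| ≤ |signedArea x y z| := fun x hx y hy z hz hxy hxz hne =>
    hmin (x, y, z) ⟨⟨hx, hy, hz⟩, hxy, hxz, hne⟩
  have h12 : a₁ ≠ a₂ := by rintro rfl; exact hD (by simp only [signedArea]; ring)
  have h13 : a₁ ≠ a₃ := by rintro rfl; exact hD (by simp only [signedArea]; ring)
  have h23 : a₂ ≠ a₃ := by rintro rfl; exact hD (by simp only [signedArea]; ring)
  obtain ⟨p, hp, hpb, hpc⟩ := h.exists_blocker_colour_ne hP h₁ h₂ h12 hc₂
  obtain ⟨q, hq, hqb, hqc⟩ := h.exists_blocker_colour_ne hP h₁ h₃ h13 hc₃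
  obtain ⟨r, hr, hrb, hrc⟩ := h.exists_blocker_colour_ne hP h₂ h₃ h23 (hc₂.symm.trans hc₃)
  rw [← hc₂] at hrc
  have hcol : c p = c q ∨ c p = c r ∨ c q = c r := by omega
  have e2 : signedArea a₂ a₁ a₃ = -signedArea a₁ a₂ a₃ := by simp only [signedArea]; ring
  have e3 : signedArea a₃ a₁ a₂ = signedArea a₁ a₂ a₃ := by simp only [signedArea]; ring
  rcases hcol with e | e | e
  · exact h.false_of_minimal_triangle hP h₂ h₃ hc₂ hc₃ hD hmin hp hq hr hpb hqb hrb hpc hrc e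
  · refine h.false_of_minimal_triangle (a₁ := a₂) (a₂ := a₁) (a₃ := a₃) hP h₁ h₃ hc₂.symm
      (hc₂.symm.trans hc₃) (by rw [e2]; exact neg_ne_zero.2 hD) (by rwa [e2, abs_neg])
      hp hr hq (by rwa [openSegment_symm]) hrb hqb ?_ ?_ e
    · rwa [← hc₂]
    · rwa [← hc₂]
  · refine h.false_of_minimal_triangle (a₁ := a₃) (a₂ := a₁) (a₃ := a₂) hP h₁ h₂ hc₃.symm
      (hc₃.symm.trans hc₂) (by rwa [e3]) (by rwa [e3])
      hq hr hp (by rwa [openSegment_symm]) (by rwa [openSegment_symm]) hpb ?_ ?_ e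
    · rwa [← hc₃]
    · rwa [← hc₃]

end BlockedColouring

/-- First coordinates of the pinwheel: a triangle together with one point on the
prolongation of each side. -/
def pinwheelX : Fin 6 → ℤ := ![0, 1, 0, 2, -1, 0]

/-- Second coordinates of the pinwheel. -/
def pinwheelY : Fin 6 → ℤ := ![0, 0, 1, 0, 2, -1]

/-- The colours of the points of the pinwheel. -/
def pinwheelColour : Fin 6 → Fin 3 := ![0, 1, 2, 0, 1, 2]

/-- The pinwheel as a configuration in the real plane. -/
def pinwheel (i : Fin 6) : ℝ × ℝ := (pinwheelX i, pinwheelY i)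

theorem pinwheel_injective : Function.Injective pinwheel := by
  intro i j hij
  simp only [pinwheel, Prod.mk.injEq, Int.cast_inj] at hij
  revert i j
  decide

/-- The point `x` of the pinwheel lies between the points `i` and `j`. -/
def PinwheelBlocks (x i j : Fin 6) : Prop :=
  (pinwheelX x - pinwheelX i) * (pinwheelY x - pinwheelY j) -
      (pinwheelY x - pinwheelY i) * (pinwheelX x - pinwheelX j) = 0 ∧
    (pinwheelX x - pinwheelX i) * (pinwheelX x - pinwheelX j) +
      (pinwheelY x - pinwheelY i) * (pinwheelY x - pinwheelY j) < 0

instance (x i j : Fin 6) : Decidable (PinwheelBlocks x i j) :=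
  inferInstanceAs (Decidable (_ ∧ _))

theorem blocks_pinwheel_iff {i j : Fin 6} (x : Fin 6) (hij : i ≠ j) :
    Blocks (pinwheel x) (pinwheel i) (pinwheel j) ↔ PinwheelBlocks x i j := by
  rw [Blocks, mem_openSegment_prod_iff_cross_dot _ _ _ (pinwheel_injective.ne hij)]
  simp only [pinwheel, PinwheelBlocks]
  norm_cast

theorem representable_of_pinwheel (s : Finset (Fin 6))
    (hs : ∀ i ∈ s, ∀ j ∈ s, i ≠ j →
      ((∀ x ∈ s, ¬ PinwheelBlocks x i j) ↔ pinwheelColour i ≠ pinwheelColour j)) :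
    Representable (Finset.univ.val.map
      fun l : Fin 3 => (s.filter (fun i => pinwheelColour i = l)).card) := by
  have hcol : ∀ i, Function.extend pinwheel pinwheelColour 0 (pinwheel i) = pinwheelColour i :=
    fun i => pinwheel_injective.extend_apply _ _ i
  refine ⟨pinwheel '' s, s.finite_toSet.image _, 3,
    Function.extend pinwheel pinwheelColour 0, ?_, ?_⟩
  · rintro _ ⟨i, hi, rfl⟩ _ ⟨j, hj, rfl⟩ hne
    have hij : i ≠ j := fun e => hne (congrArg _ e)
    rw [hcol, hcol, ← hs i hi j hj hij]
    simp only [Visible, Set.forall_mem_image, SetLike.mem_coe, blocks_pinwheel_iff _ hij]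
  · refine congrArg (fun g => Multiset.map g _) (funext fun l => ?_)
    have : pinwheel '' s ∩ Function.extend pinwheel pinwheelColour 0 ⁻¹' {l} =
        pinwheel '' (s.filter (fun i => pinwheelColour i = l) : Finset (Fin 6)) := by
      ext z
      constructor
      · rintro ⟨⟨i, hi, rfl⟩, hz⟩
        exact ⟨i, Finset.mem_coe.2 (Finset.mem_filter.2 ⟨hi, (hcol i).symm.trans hz⟩), rfl⟩
      · rintro ⟨i, hi, rfl⟩
        rw [Finset.mem_coe, Finset.mem_filter] at hi
        exact ⟨⟨i, hi.1, rfl⟩, (hcol i).trans hi.2⟩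
    rw [this, Set.ncard_image_of_injective _ pinwheel_injective, Set.ncard_coe_finset]

/-- `{1,1,1}`, `{1,1,2}`, `{1,2,2}` and `{2,2,2}` are the only representable 3-sets. -/
theorem representable_three_sets (n₁ n₂ n₃ : ℕ) (h₁ : 0 < n₁) (h₂ : 0 < n₂) (h₃ : 0 < n₃) :
    Representable {n₁, n₂, n₃} ↔
      ({n₁, n₂, n₃} : Multiset ℕ) = {1, 1, 1} ∨
      ({n₁, n₂, n₃} : Multiset ℕ) = {1, 1, 2} ∨
      ({n₁, n₂, n₃} : Multiset ℕ) = {1, 2, 2} ∨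
      ({n₁, n₂, n₃} : Multiset ℕ) = {2, 2, 2} := by
  constructor
  · rintro ⟨P, hP, k, c, hc, hN⟩
    obtain rfl : k = 3 := by
      simpa using (congrArg Multiset.card hN).symm
    have hle : ∀ n ∈ ({n₁, n₂, n₃} : Multiset ℕ), n ≤ 2 := by
      intro n hn
      rw [hN, Multiset.mem_map] at hn
      obtain ⟨i, -, rfl⟩ := hn
      exact hc.ncard_le_two hP i
    have l₁ : n₁ ≤ 2 := hle n₁ (by simp)
    have l₂ : n₂ ≤ 2 := hle n₂ (by simp)
    have l₃ : n₃ ≤ 2 := hle n₃ (by simp)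
    clear hN hle
    interval_cases n₁ <;> interval_cases n₂ <;> interval_cases n₃ <;> decide
  · rintro (h | h | h | h) <;> rw [h]
    · exact representable_of_pinwheel {0, 1, 2} (by decide)
    · convert representable_of_pinwheel {0, 1, 2, 3} (by decide) using 1
      decide
    · convert representable_of_pinwheel {0, 1, 2, 3, 4} (by decide) using 1
      decide
    · exact representable_of_pinwheel {0, 1, 2, 3, 4, 5} (by decide)
end

section
/- For all integers k ≥ 3 and n ≥ 2, there is a family 𝓛 of vertex subsets ('lines') of the complete k-partite graph K(n,n,…,n) (k parts each of size n) such that: each member of 𝓛 is either a 2-element set of adjacent vertices (an edge) or a 3-element set inducing a path on three vertices; every pair of distinct vertices is contained in exactly one member of 𝓛; and for every line L ∈ 𝓛 there exists a vertex adjacent to every vertex of L. In particular the edge set of K(n,…,n) is partitioned by the edges contained in the lines. -/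
section CyclicLines

variable {I A : Type*} [AddCommGroup I] [AddCommGroup A] [DecidableEq I] [DecidableEq A]

/-- The pair `(i, a)`, `(i, c)` together with its blocker `(i + d, a + c)`; this is an edge
when `a = c`. -/
def blockedPair (d i : I) (a c : A) : Finset (I × A) :=
  {(i, a), (i, c), (i + d, a + c)}

/-- The blocked pairs, together with all edges between parts that do not differ by `d`. -/
def cyclicLines (A : Type*) [AddCommGroup A] [DecidableEq A] (d : I) : Set (Finset (I × A)) :=
  {L | (∃ i a c, L = blockedPair d i a c) ∨
    ∃ u v : I × A, u.1 ≠ v.1 ∧ v.1 ≠ u.1 + d ∧ u.1 ≠ v.1 + d ∧ L = {u, v}}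

lemma blockedPair_comm (d i : I) (a c : A) : blockedPair d i a c = blockedPair d i c a := by
  ext x
  simp only [blockedPair, Finset.mem_insert, Finset.mem_singleton, add_comm a c]
  tauto

lemma mem_blockedPair {d i : I} {a c : A} {x : I × A} :
    x ∈ blockedPair d i a c ↔
      x.1 = i ∧ x.2 = a ∨ x.1 = i ∧ x.2 = c ∨ x.1 = i + d ∧ x.2 = a + c := by
  simp [blockedPair, Prod.ext_iff]

lemma eq_blockedPair_of_fst_eq {d : I} {L : Finset (I × A)} (hL : L ∈ cyclicLines A d)
    (hd : d ≠ 0) {i : I} {a c : A} (hac : a ≠ c) (ha : (i, a) ∈ L) (hc : (i, c) ∈ L) :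
    L = blockedPair d i a c := by
  obtain ⟨j, b, e, rfl⟩ | ⟨u, v, huv, -, -, rfl⟩ := hL
  · have hj : j ≠ j + d := by simpa using hd
    rw [mem_blockedPair] at ha hc
    have := blockedPair_comm d j b e
    grind
  · simp only [Finset.mem_insert, Finset.mem_singleton] at ha hc
    grind

lemma eq_blockedPair_of_fst_eq_add {d : I} {L : Finset (I × A)} (hL : L ∈ cyclicLines A d)
    (hd : d ≠ 0) (hdd : d + d ≠ 0) {i : I} {a b : A} (ha : (i, a) ∈ L) (hb : (i + d, b) ∈ L) :
    L = blockedPair d i a (b - a) := by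
  obtain ⟨j, e, f, rfl⟩ | ⟨u, v, huv, h₁, h₂, rfl⟩ := hL
  · have hj : j ≠ j + d := by simpa using hd
    have hj' : j ≠ j + d + d := by simpa [add_assoc] using hdd
    rw [mem_blockedPair] at ha hb
    have hcomm := blockedPair_comm d j e f
    have h₁ : e + f - e = f := by abel
    have h₂ : e + f - f = e := by abel
    have hi : i ≠ i + d := by simpa using hd
    grind
  · have hi : i ≠ i + d := by simpa using hd
    simp only [Finset.mem_insert, Finset.mem_singleton] at ha hb
    grind

lemma eq_pair_of_fst_ne {d : I} {L : Finset (I × A)} (hL : L ∈ cyclicLines A d)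
    {u v : I × A} (huv : u.1 ≠ v.1) (h₁ : v.1 ≠ u.1 + d) (h₂ : u.1 ≠ v.1 + d)
    (hu : u ∈ L) (hv : v ∈ L) : L = {u, v} := by
  obtain ⟨j, e, f, rfl⟩ | ⟨u', v', -, -, -, rfl⟩ := hL
  · rw [mem_blockedPair] at hu hv
    grind
  · simp only [Finset.mem_insert, Finset.mem_singleton] at hu hv
    have := Finset.pair_comm u' v'
    grind

lemma existsUnique_mem_cyclicLines {d : I} (hd : d ≠ 0) (hdd : d + d ≠ 0) {u v : I × A}
    (huv : u ≠ v) : ∃! L, L ∈ cyclicLines A d ∧ u ∈ L ∧ v ∈ L := by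
  obtain ⟨i, a⟩ := u
  obtain ⟨j, b⟩ := v
  by_cases hij : i = j
  · subst hij
    have hab : a ≠ b := fun h => huv (by rw [h])
    exact ⟨blockedPair d i a b, ⟨.inl ⟨i, a, b, rfl⟩, by simp [mem_blockedPair],
      by simp [mem_blockedPair]⟩, fun L ⟨hL, hu, hv⟩ =>
        eq_blockedPair_of_fst_eq hL hd hab hu hv⟩
  by_cases hj : j = i + d
  · subst hj
    exact ⟨blockedPair d i a (b - a), ⟨.inl ⟨i, a, b - a, rfl⟩, by simp [mem_blockedPair],
      by simp [mem_blockedPair]⟩, fun L ⟨hL, hu, hv⟩ =>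
        eq_blockedPair_of_fst_eq_add hL hd hdd hu hv⟩
  by_cases hi : i = j + d
  · subst hi
    exact ⟨blockedPair d j b (a - b), ⟨.inl ⟨j, b, a - b, rfl⟩, by simp [mem_blockedPair],
      by simp [mem_blockedPair]⟩, fun L ⟨hL, hu, hv⟩ =>
        eq_blockedPair_of_fst_eq_add hL hd hdd hv hu⟩
  exact ⟨{(i, a), (j, b)}, ⟨.inr ⟨_, _, hij, hj, hi, rfl⟩, by simp, by simp⟩,
    fun L ⟨hL, hu, hv⟩ => eq_pair_of_fst_ne hL hij hj hi hu hv⟩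

lemma edge_or_path_of_mem_cyclicLines {d : I} (hd : d ≠ 0) {L : Finset (I × A)}
    (hL : L ∈ cyclicLines A d) :
    (∃ a b : I × A, a ≠ b ∧ a.1 ≠ b.1 ∧ L = {a, b}) ∨
      ∃ a b c : I × A, a ≠ b ∧ b ≠ c ∧ a ≠ c ∧ a.1 ≠ b.1 ∧ b.1 ≠ c.1 ∧ a.1 = c.1 ∧
        L = {a, b, c} := by
  obtain ⟨i, a, c, rfl⟩ | ⟨u, v, huv, -, -, rfl⟩ := hL
  · by_cases hac : a = c
    · subst hac
      exact .inl ⟨(i, a), (i + d, a + a), by simp [hd], by simp [hd], by simp [blockedPair]⟩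
    · exact .inr ⟨(i, a), (i + d, a + c), (i, c), by simp [hd], by simp [hd], by simp [hac],
        by simp [hd], by simp [hd], rfl, by rw [blockedPair, Finset.pair_comm (i, c)]⟩
  · exact .inl ⟨u, v, fun h => huv (by rw [h]), huv, rfl⟩

lemma exists_fst_ne_of_mem_cyclicLines {d : I} (hd : d ≠ 0) (hdd : d + d ≠ 0)
    {L : Finset (I × A)} (hL : L ∈ cyclicLines A d) : ∃ x : I × A, ∀ y ∈ L, x.1 ≠ y.1 := by
  obtain ⟨i, a, c, rfl⟩ | ⟨u, v, -, h, -, rfl⟩ := hL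
  · exact ⟨(i + d + d, 0), by simp [blockedPair, add_assoc, hd, hdd]⟩
  · exact ⟨(u.1 + d, 0), by simp [hd, h.symm]⟩

end CyclicLines

/-- The edge set of the complete `k`-partite Turán graph `K(n,…,n)` (vertices
`Fin k × Fin n`, adjacency iff distinct first coordinates) can be partitioned into
"lines", each an edge or an induced path on three vertices, such that every pair of
vertices lies in exactly one line, and every line has a vertex adjacent to all of it. -/
theorem turan_lines (k n : ℕ) (hk : 3 ≤ k) (hn : 2 ≤ n) :
    ∃ 𝓛 : Set (Finset (Fin k × Fin n)),
      (∀ L ∈ 𝓛,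
        (∃ a b : Fin k × Fin n, a ≠ b ∧ a.1 ≠ b.1 ∧ L = {a, b}) ∨
        (∃ a b c : Fin k × Fin n, a ≠ b ∧ b ≠ c ∧ a ≠ c ∧
          a.1 ≠ b.1 ∧ b.1 ≠ c.1 ∧ a.1 = c.1 ∧ L = {a, b, c})) ∧
      (∀ u v : Fin k × Fin n, u ≠ v → ∃! L, L ∈ 𝓛 ∧ u ∈ L ∧ v ∈ L) ∧
      (∀ L ∈ 𝓛, ∃ x : Fin k × Fin n, ∀ y ∈ L, x.1 ≠ y.1) := by
  have : NeZero k := ⟨by omega⟩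
  have : NeZero n := ⟨by omega⟩
  have hd : (1 : Fin k) ≠ 0 := by
    simp [Fin.ext_iff, Nat.mod_eq_of_lt (show 1 < k by omega)]
  have hdd : (1 + 1 : Fin k) ≠ 0 := by
    simp [Fin.ext_iff, Fin.val_add, Nat.mod_eq_of_lt (show 2 < k by omega)]
  exact ⟨cyclicLines (Fin n) (1 : Fin k), fun L hL => edge_or_path_of_mem_cyclicLines hd hL,
    fun u v huv => existsUnique_mem_cyclicLines hd hdd huv,
    fun L hL => exists_fst_ne_of_mem_cyclicLines hd hdd hL⟩
end

section
/- If P is a k-blocked point set (for some k ≥ 1) consisting of n points, and the largest colour class of P has m points, then n ≥ 3m − 3. -/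
theorem mem_openSegment_iff_sbtw {E : Type*} [AddCommGroup E] [Module ℝ E] {x y z : E}
    (hxz : x ≠ z) : y ∈ openSegment ℝ x z ↔ Sbtw ℝ x y z := by
  rw [sbtw_iff_mem_image_Ioo_and_ne, openSegment_eq_image_lineMap]
  exact (and_iff_left hxz).symm

/-- In a blocked colouring no point lies strictly between two points of its own colour. -/
theorem BlockedColouring.not_mem_openSegment {E : Type*} [NormedAddCommGroup E] [NormedSpace ℝ E]
    {k : ℕ} {P : Set E} (hfin : P.Finite) {c : E → Fin k} (hc : BlockedColouring P c)
    {x y z : E} (hx : x ∈ P) (hy : y ∈ P) (hz : z ∈ P) (hxy : c x = c y) (hyz : c y = c z)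
    (hxz : x ≠ z) : y ∉ openSegment ℝ x z := by
  intro hmem
  have sxyz : Sbtw ℝ x y z := by rwa [← mem_openSegment_iff_sbtw hxz]
  have hne : (P ∩ openSegment ℝ x y).Nonempty := by
    by_contra hempty
    refine (hc x hx y hy sxyz.ne_left.symm).1 (fun w hw hb => hempty ⟨w, hw, hb⟩) hxy
  obtain ⟨w, ⟨hwP, hw⟩, hwmin⟩ :=
    Set.exists_min_image _ (fun w => ‖w - y‖) (hfin.subset Set.inter_subset_left) hne
  have sxwy : Sbtw ℝ x w y := by rwa [← mem_openSegment_iff_sbtw sxyz.ne_left.symm]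
  have hwy : w ≠ y := sxwy.ne_right
  have swyz : Sbtw ℝ w y z := sxyz.trans_left_right sxwy
  have hvis : Visible P w y := by
    intro v hv hb
    have swvy : Sbtw ℝ w v y := by rwa [← mem_openSegment_iff_sbtw hwy]
    have hvxy : v ∈ openSegment ℝ x y := by
      rw [mem_openSegment_iff_sbtw sxyz.ne_left.symm]
      exact sxwy.trans_right swvy
    have hle := hwmin v ⟨hv, hvxy⟩
    obtain ⟨a, b, ha, hb, hab, rfl⟩ := hb
    have hsub : a • w + b • y - y = a • (w - y) := by
      rw [← eq_sub_iff_add_eq] at hab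
      subst hab
      module
    simp only [hsub, norm_smul, Real.norm_eq_abs, abs_of_pos ha] at hle
    have := norm_pos_iff.2 (sub_ne_zero.2 hwy)
    nlinarith
  have hwyc := (hc w hwP y hy hwy).1 hvis
  have hwz : ¬ Visible P w z := fun h =>
    h y hy ((mem_openSegment_iff_sbtw swyz.left_ne_right).2 swyz)
  rw [hc w hwP z hz swyz.left_ne_right, not_not] at hwz
  exact hwyc (hwz.trans hyz.symm)

/-- A farthest point from the origin is the strict maximum of the functional it represents. -/
theorem inner_sub_pos_of_norm_le {p q : ℝ × ℝ} (hqp : q ≠ p)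
    (h : q.1 ^ 2 + q.2 ^ 2 ≤ p.1 ^ 2 + p.2 ^ 2) :
    0 < p.1 * (p.1 - q.1) + p.2 * (p.2 - q.2) := by
  have hpos : 0 < (p.1 - q.1) ^ 2 + (p.2 - q.2) ^ 2 := by
    by_contra hle
    refine hqp (Prod.ext ?_ ?_) <;> nlinarith [sq_nonneg (p.1 - q.1), sq_nonneg (p.2 - q.2)]
  nlinarith

/-- The tangent of the angle, seen from `p`, between `q` and the origin. -/
noncomputable def angularSlope (p q : ℝ × ℝ) : ℝ :=
  (p.1 * (p.2 - q.2) - p.2 * (p.1 - q.1)) / (p.1 * (p.1 - q.1) + p.2 * (p.2 - q.2))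

/-- Two points seen from `p` in the same direction are collinear with `p`, on the same side. -/
theorem mem_openSegment_of_angularSlope_eq {p q r : ℝ × ℝ} (hqr : q ≠ r)
    (hq : 0 < p.1 * (p.1 - q.1) + p.2 * (p.2 - q.2))
    (hr : 0 < p.1 * (p.1 - r.1) + p.2 * (p.2 - r.2))
    (h : angularSlope p q = angularSlope p r) :
    q ∈ openSegment ℝ p r ∨ r ∈ openSegment ℝ p q := by
  wlog hle : p.1 * (p.1 - q.1) + p.2 * (p.2 - q.2) ≤ p.1 * (p.1 - r.1) + p.2 * (p.2 - r.2)
    generalizing q r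
  · exact (this hqr.symm hr hq h.symm (le_of_not_ge hle)).symm
  rw [angularSlope, angularSlope, div_eq_div_iff hq.ne' hr.ne'] at h
  set α := p.1 * (p.1 - q.1) + p.2 * (p.2 - q.2) with hα
  set β := p.1 * (p.1 - r.1) + p.2 * (p.2 - r.2) with hβ
  have hp : p.1 ^ 2 + p.2 ^ 2 ≠ 0 := by
    intro h0
    have h1 : p.1 = 0 := by nlinarith [sq_nonneg p.1, sq_nonneg p.2]
    have h2 : p.2 = 0 := by nlinarith [sq_nonneg p.1, sq_nonneg p.2]
    simp [hα, h1, h2] at hq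
  have e1 : β * (p.1 - q.1) = α * (p.1 - r.1) := by
    apply mul_left_cancel₀ hp
    linear_combination -p.2 * h - β * p.1 * hα + α * p.1 * hβ
  have e2 : β * (p.2 - q.2) = α * (p.2 - r.2) := by
    apply mul_left_cancel₀ hp
    linear_combination p.1 * h - β * p.2 * hα + α * p.2 * hβ
  have hlt : α < β := by
    refine lt_of_le_of_ne hle fun heq => hqr ?_
    rw [heq] at e1 e2
    have e1' := mul_left_cancel₀ hr.ne' e1
    have e2' := mul_left_cancel₀ hr.ne' e2
    exact Prod.ext (by linarith) (by linarith)
  refine Or.inl ⟨1 - α / β, α / β, by rw [sub_pos, div_lt_one hr]; exact hlt,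
    div_pos hq hr, by ring, Prod.ext ?_ ?_⟩
  · simp only [Prod.fst_add, Prod.smul_fst, smul_eq_mul]
    field_simp
    linear_combination e1
  · simp only [Prod.snd_add, Prod.smul_snd, smul_eq_mul]
    field_simp
    linear_combination e2

/-- An affine function on the plane that vanishes at `p` and at the points of angular slope `t`. -/
def slopeForm (p : ℝ × ℝ) (t : ℝ) (x : ℝ × ℝ) : ℝ :=
  (p.1 * (p.2 - x.2) - p.2 * (p.1 - x.1)) - t * (p.1 * (p.1 - x.1) + p.2 * (p.2 - x.2))

theorem slopeForm_self (p : ℝ × ℝ) (t : ℝ) : slopeForm p t p = 0 := by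
  simp [slopeForm]

theorem slopeForm_eq_mul {p q : ℝ × ℝ} (t : ℝ)
    (hq : 0 < p.1 * (p.1 - q.1) + p.2 * (p.2 - q.2)) :
    slopeForm p t q =
      (angularSlope p q - t) * (p.1 * (p.1 - q.1) + p.2 * (p.2 - q.2)) := by
  rw [slopeForm, angularSlope, sub_mul, div_mul_cancel₀ _ hq.ne']

theorem slopeForm_combo (p : ℝ × ℝ) (t : ℝ) (x y : ℝ × ℝ) {a b : ℝ} (hab : a + b = 1) :
    slopeForm p t (a • x + b • y) = a * slopeForm p t x + b * slopeForm p t y := by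
  obtain rfl := eq_sub_of_add_eq hab
  simp only [slopeForm, Prod.fst_add, Prod.snd_add, Prod.smul_fst, Prod.smul_snd, smul_eq_mul]
  ring

/-- If `f` is affine on segments, vanishes at `u` and is positive on the rest of `S`, then it is
positive strictly between any two points of `S`. -/
theorem pos_of_mem_openSegment {f : ℝ × ℝ → ℝ}
    (hf : ∀ x y : ℝ × ℝ, ∀ a b : ℝ, a + b = 1 → f (a • x + b • y) = a * f x + b * f y)
    {S : Set (ℝ × ℝ)} {u : ℝ × ℝ} (hu : f u = 0) (hS : ∀ x ∈ S, x ≠ u → 0 < f x)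
    {x y z : ℝ × ℝ} (hx : x ∈ S) (hy : y ∈ S) (hxy : x ≠ y) (hz : z ∈ openSegment ℝ x y) :
    0 < f z := by
  obtain ⟨a, b, ha, hb, hab, rfl⟩ := hz
  rw [hf x y a b hab]
  by_cases hxu : x = u
  · have := mul_pos hb (hS y hy (fun h => hxy (hxu.trans h.symm)))
    rw [hxu, hu]
    linarith
  · have h1 := mul_pos ha (hS x hx hxu)
    by_cases hyu : y = u
    · rw [hyu, hu]
      linarith
    · have := mul_pos hb (hS y hy hyu)
      linarith

theorem eq_zero_of_mem_openSegment {f : ℝ × ℝ → ℝ}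
    (hf : ∀ x y : ℝ × ℝ, ∀ a b : ℝ, a + b = 1 → f (a • x + b • y) = a * f x + b * f y)
    {p u z : ℝ × ℝ} (hp : f p = 0) (hu : f u = 0) (hz : z ∈ openSegment ℝ p u) : f z = 0 := by
  obtain ⟨a, b, ha, hb, hab, rfl⟩ := hz
  rw [hf p u a b hab, hp, hu]
  ring

/-- A finite set of at least three points, none strictly between two others, has a point `p` and
two others `u`, `v` such that the segments `pu`, `pv` meet neither each other nor any segment
spanned by the points other than `p`. -/
theorem exists_extreme_point_with_tangents {S : Finset (ℝ × ℝ)} (hcard : 3 ≤ S.card)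
    (hS : ∀ x ∈ S, ∀ y ∈ S, ∀ z ∈ S, x ≠ z → y ∉ openSegment ℝ x z) :
    ∃ p ∈ S, ∃ u ∈ S.erase p, ∃ v ∈ S.erase p,
      Disjoint (openSegment ℝ p u) (openSegment ℝ p v) ∧
      ∀ x ∈ S.erase p, ∀ y ∈ S.erase p, x ≠ y →
        Disjoint (openSegment ℝ p u) (openSegment ℝ x y) ∧
        Disjoint (openSegment ℝ p v) (openSegment ℝ x y) := by
  obtain ⟨p, hp, hpmax⟩ := S.exists_max_image (fun q => q.1 ^ 2 + q.2 ^ 2)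
    (Finset.card_pos.1 (by omega))
  have hpos : ∀ q ∈ S.erase p, 0 < p.1 * (p.1 - q.1) + p.2 * (p.2 - q.2) := fun q hq =>
    inner_sub_pos_of_norm_le (Finset.ne_of_mem_erase hq) (hpmax q (Finset.mem_of_mem_erase hq))
  have hcard' : 1 < (S.erase p).card := by rw [Finset.card_erase_of_mem hp]; omega
  have hinj : ∀ q ∈ S.erase p, ∀ r ∈ S.erase p, q ≠ r → angularSlope p q ≠ angularSlope p r := by
    intro q hq r hr hqr h
    rw [Finset.mem_erase] at hq hr
    rcases mem_openSegment_of_angularSlope_eq hqr (hpos q (Finset.mem_erase.2 hq))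
      (hpos r (Finset.mem_erase.2 hr)) h with h | h
    · exact hS p hp q hq.2 r hr.2 hr.1.symm h
    · exact hS p hp r hr.2 q hq.2 hq.1.symm h
  have hne : (S.erase p).Nonempty := Finset.card_pos.1 (by omega)
  obtain ⟨u, hu, humin⟩ := (S.erase p).exists_min_image (angularSlope p) hne
  obtain ⟨v, hv, hvmax⟩ := (S.erase p).exists_max_image (angularSlope p) hne
  have huv : v ≠ u := by
    rintro rfl
    obtain ⟨x, hx, y, hy, hxy⟩ := Finset.one_lt_card.1 hcard'
    exact hinj x hx y hy hxy (le_antisymm ((hvmax x hx).trans (humin y hy))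
      ((hvmax y hy).trans (humin x hx)))
  let f : ℝ × ℝ → ℝ := slopeForm p (angularSlope p u)
  let g : ℝ × ℝ → ℝ := fun x => -slopeForm p (angularSlope p v) x
  have hf : ∀ x y : ℝ × ℝ, ∀ a b : ℝ, a + b = 1 → f (a • x + b • y) = a * f x + b * f y :=
    fun x y a b hab => slopeForm_combo p _ x y hab
  have hg : ∀ x y : ℝ × ℝ, ∀ a b : ℝ, a + b = 1 → g (a • x + b • y) = a * g x + b * g y := by
    intro x y a b hab
    simp only [g, slopeForm_combo p _ x y hab]
    ring
  have hfp : f p = 0 := slopeForm_self p _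
  have hgp : g p = 0 := by simp only [g, slopeForm_self, neg_zero]
  have hfu : f u = 0 := by simp only [f, slopeForm_eq_mul _ (hpos u hu), sub_self, zero_mul]
  have hgv : g v = 0 := by
    simp only [g, slopeForm_eq_mul _ (hpos v hv), sub_self, zero_mul, neg_zero]
  have hfpos : ∀ x ∈ (S.erase p : Set (ℝ × ℝ)), x ≠ u → 0 < f x := by
    intro x hx hxu
    simp only [f, slopeForm_eq_mul _ (hpos x hx)]
    exact mul_pos (sub_pos.2 (lt_of_le_of_ne (humin x hx) (hinj u hu x hx hxu.symm))) (hpos x hx)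
  have hgpos : ∀ x ∈ (S.erase p : Set (ℝ × ℝ)), x ≠ v → 0 < g x := by
    intro x hx hxv
    simp only [g, slopeForm_eq_mul _ (hpos x hx), ← neg_mul, neg_sub]
    exact mul_pos (sub_pos.2 (lt_of_le_of_ne (hvmax x hx) (hinj x hx v hv hxv))) (hpos x hx)
  refine ⟨p, hp, u, hu, v, hv, ?_, fun x hx y hy hxy => ⟨?_, ?_⟩⟩ <;>
    refine Set.disjoint_left.2 fun z hz hz' => ?_
  · have h0 := eq_zero_of_mem_openSegment hf hfp hfu hz
    obtain ⟨a, b, ha, hb, hab, rfl⟩ := hz'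
    rw [hf _ _ _ _ hab, hfp] at h0
    have := mul_pos hb (hfpos v hv huv)
    linarith
  · exact (pos_of_mem_openSegment hf hfu hfpos hx hy hxy hz').ne'
      (eq_zero_of_mem_openSegment hf hfp hfu hz)
  · exact (pos_of_mem_openSegment hg hgv hgpos hx hy hxy hz').ne'
      (eq_zero_of_mem_openSegment hg hgp hgv hz)

/-- Blocking all pairs of `m` points, none strictly between two others, needs at least `2m - 3`
blockers. -/
theorem two_mul_card_le_card_blockers_add_three (S B : Finset (ℝ × ℝ))
    (hS : ∀ x ∈ S, ∀ y ∈ S, ∀ z ∈ S, x ≠ z → y ∉ openSegment ℝ x z)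
    (hB : ∀ x ∈ S, ∀ y ∈ S, x ≠ y → ∃ b ∈ B, b ∈ openSegment ℝ x y) :
    2 * S.card ≤ B.card + 3 := by
  classical
  induction hn : S.card generalizing S B with
  | zero => omega
  | succ n ih =>
    rcases lt_or_ge S.card 3 with hlt | hge
    · by_cases h1 : 1 < S.card
      · obtain ⟨x, hx, y, hy, hxy⟩ := Finset.one_lt_card.1 h1
        obtain ⟨b, hb, -⟩ := hB x hx y hy hxy
        have := Finset.card_pos.2 ⟨b, hb⟩
        omega
      · omega
    · obtain ⟨p, hp, u, hu, v, hv, huv, hdisj⟩ := exists_extreme_point_with_tangents hge hS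
      let inner : Finset (ℝ × ℝ) :=
        B.filter fun b => ∃ x ∈ S.erase p, ∃ y ∈ S.erase p, x ≠ y ∧ b ∈ openSegment ℝ x y
      have hinner : 2 * n ≤ inner.card + 3 := by
        refine ih (S.erase p) inner
          (fun x hx y hy z hz => hS x (Finset.mem_of_mem_erase hx) y (Finset.mem_of_mem_erase hy)
            z (Finset.mem_of_mem_erase hz)) (fun x hx y hy hxy => ?_) ?_
        · obtain ⟨b, hb, hbxy⟩ :=
            hB x (Finset.mem_of_mem_erase hx) y (Finset.mem_of_mem_erase hy) hxy
          exact ⟨b, Finset.mem_filter.2 ⟨hb, x, hx, y, hy, hxy, hbxy⟩, hbxy⟩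
        · rw [Finset.card_erase_of_mem hp]
          omega
      obtain ⟨b₁, hb₁, hb₁u⟩ :=
        hB p hp u (Finset.mem_of_mem_erase hu) (Finset.ne_of_mem_erase hu).symm
      obtain ⟨b₂, hb₂, hb₂v⟩ :=
        hB p hp v (Finset.mem_of_mem_erase hv) (Finset.ne_of_mem_erase hv).symm
      have hne : b₁ ≠ b₂ := fun h => Set.disjoint_left.1 huv hb₁u (h ▸ hb₂v)
      have hn₁ : b₁ ∉ inner := by
        intro h
        obtain ⟨-, x, hx, y, hy, hxy, hmem⟩ := Finset.mem_filter.1 h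
        exact Set.disjoint_left.1 (hdisj x hx y hy hxy).1 hb₁u hmem
      have hn₂ : b₂ ∉ inner := by
        intro h
        obtain ⟨-, x, hx, y, hy, hxy, hmem⟩ := Finset.mem_filter.1 h
        exact Set.disjoint_left.1 (hdisj x hx y hy hxy).2 hb₂v hmem
      have hsub : insert b₁ (insert b₂ inner) ⊆ B :=
        Finset.insert_subset hb₁ (Finset.insert_subset hb₂ (Finset.filter_subset _ _))
      have hcard := Finset.card_le_card hsub
      rw [Finset.card_insert_of_notMem (by simp [hne, hn₁]),
        Finset.card_insert_of_notMem hn₂] at hcard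
      omega

/-- If a `k`-blocked set has `n` points and its largest colour class has `m` points,
then `n ≥ 3m - 3`. -/
theorem blocked_largest_colour_class (k : ℕ) (hk : 1 ≤ k) (P : Set (ℝ × ℝ))
    (hfin : P.Finite) (c : (ℝ × ℝ) → Fin k) (hc : BlockedColouring P c)
    (m : ℕ) (hex : ∃ i : Fin k, (P ∩ c ⁻¹' {i}).ncard = m)
    (hmax : ∀ i : Fin k, (P ∩ c ⁻¹' {i}).ncard ≤ m) :
    3 * (m : ℤ) - 3 ≤ (P.ncard : ℤ) := by
  classical
  obtain ⟨i, rfl⟩ := hex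
  lift P to Finset (ℝ × ℝ) using hfin
  have hS : (P : Set (ℝ × ℝ)) ∩ c ⁻¹' {i} = (P.filter fun x => c x = i : Finset (ℝ × ℝ)) := by
    ext x
    simp
  rw [hS, Set.ncard_coe_finset, Set.ncard_coe_finset]
  have hgen : ∀ x ∈ P.filter (fun x => c x = i), ∀ y ∈ P.filter (fun x => c x = i),
      ∀ z ∈ P.filter (fun x => c x = i), x ≠ z → y ∉ openSegment ℝ x z := by
    intro x hx y hy z hz hxz
    rw [Finset.mem_filter] at hx hy hz
    exact hc.not_mem_openSegment P.finite_toSet hx.1 hy.1 hz.1 (hx.2.trans hy.2.symm)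
      (hy.2.trans hz.2.symm) hxz
  have hbound := two_mul_card_le_card_blockers_add_three (P.filter fun x => c x = i)
    (P.filter fun x => ¬ c x = i) hgen (by
      intro x hx y hy hxy
      have hxP := Finset.mem_filter.1 hx
      have hyP := Finset.mem_filter.1 hy
      have hnv : ¬ Visible (P : Set (ℝ × ℝ)) x y := fun h =>
        (hc x hxP.1 y hyP.1 hxy).1 h (hxP.2.trans hyP.2.symm)
      simp only [Visible, Blocks, not_forall, not_not] at hnv
      obtain ⟨b, hb, hbxy⟩ := hnv
      exact ⟨b, Finset.mem_filter.2 ⟨hb, fun hbi =>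
        hgen x hx b (Finset.mem_filter.2 ⟨hb, hbi⟩) y hy hxy hbxy⟩, hbxy⟩)
  have hsum := Finset.card_filter_add_card_filter_not (s := P) (fun x => c x = i)
  omega
end

section
/- Every 4-blocked point set in the plane has at most 36 points. -/
/-! ### Orientation of planar triples -/

/-- The signed doubled area of the triangle `p q r`; it is positive when the triangle is
counterclockwise. -/
def orient (p q r : ℝ × ℝ) : ℝ :=
  (q.1 - p.1) * (r.2 - p.2) - (q.2 - p.2) * (r.1 - p.1)

theorem orient_rotate (p q r : ℝ × ℝ) : orient q r p = orient p q r := by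
  simp only [orient]; ring

theorem orient_swap (p q r : ℝ × ℝ) : orient q p r = -orient p q r := by
  simp only [orient]; ring

@[simp] theorem orient_self_left (p q : ℝ × ℝ) : orient p q p = 0 := by
  simp only [orient]; ring

@[simp] theorem orient_self_right (p q : ℝ × ℝ) : orient p q q = 0 := by
  simp only [orient]; ring

@[simp] theorem orient_self_self (p q : ℝ × ℝ) : orient p p q = 0 := by
  simp only [orient]; ring

theorem orient_add_orient_add_orient (u v w p : ℝ × ℝ) :
    orient u v p + orient v w p + orient w u p = orient u v w := by
  simp only [orient]; ring

/-- Barycentric coordinates: an affine functional at `r` in terms of its values at `a`, `b`, `c`. -/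
theorem orient_barycentric (a b c r u v : ℝ × ℝ) :
    orient u v r * orient a b c =
      orient b c r * orient u v a + orient c a r * orient u v b + orient a b r * orient u v c := by
  simp only [orient]; ring

theorem eq_of_orient_eq_zero {d a b v : ℝ × ℝ} (h : 0 < orient d a b)
    (h₁ : orient a b v = 0) (h₂ : orient d a v = 0) : v = a := by
  have e₁ := h.ne'
  have k₁ : (v.1 - a.1) * orient d a b = 0 := by
    have : (v.1 - a.1) * orient d a b
      = (b.1 - a.1) * orient d a v - (d.1 - a.1) * -orient a b v := by
      simp only [orient]; ring
    rw [this, h₁, h₂]; ring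
  have k₂ : (v.2 - a.2) * orient d a b = 0 := by
    have : (v.2 - a.2) * orient d a b
      = (b.2 - a.2) * orient d a v - (d.2 - a.2) * -orient a b v := by
      simp only [orient]; ring
    rw [this, h₁, h₂]; ring
  have h1 := (mul_eq_zero.1 k₁).resolve_right e₁
  have h2 := (mul_eq_zero.1 k₂).resolve_right e₁
  exact Prod.ext (by linarith) (by linarith)

/-! ### Strict betweenness and orientation -/

theorem Sbtw.orient_eq {v x w : ℝ × ℝ} (h : Sbtw ℝ v x w) :
    ∃ t : ℝ, 0 < t ∧ t < 1 ∧
      ∀ a b, orient a b x = (1 - t) * orient a b v + t * orient a b w := by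
  obtain ⟨⟨t, ⟨h0, h1⟩, rfl⟩, -⟩ := sbtw_iff_mem_image_Ioo_and_ne.1 h
  refine ⟨t, h0, h1, fun a b => ?_⟩
  simp only [orient, AffineMap.lineMap_apply_module, Prod.fst_add, Prod.snd_add, Prod.smul_fst,
    Prod.smul_snd, smul_eq_mul]
  ring

theorem Sbtw.orient_nonneg {v x w a b : ℝ × ℝ} (h : Sbtw ℝ v x w)
    (hv : 0 ≤ orient a b v) (hw : 0 ≤ orient a b w) : 0 ≤ orient a b x := by
  obtain ⟨t, h0, h1, ht⟩ := h.orient_eq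
  rw [ht]
  exact add_nonneg (mul_nonneg (by linarith) hv) (mul_nonneg h0.le hw)

theorem Sbtw.orient_pos {v x w a b : ℝ × ℝ} (h : Sbtw ℝ v x w)
    (hv : 0 ≤ orient a b v) (hw : 0 ≤ orient a b w)
    (hp : 0 < orient a b v ∨ 0 < orient a b w) : 0 < orient a b x := by
  obtain ⟨t, h0, h1, ht⟩ := h.orient_eq
  have h1' : 0 < 1 - t := by linarith
  rw [ht]
  rcases hp with hp | hp
  · exact add_pos_of_pos_of_nonneg (mul_pos h1' hp) (mul_nonneg h0.le hw)
  · exact add_pos_of_nonneg_of_pos (mul_nonneg h1'.le hv) (mul_pos h0 hp)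

theorem Sbtw.orient_eq_zero {v x w a b : ℝ × ℝ} (h : Sbtw ℝ v x w)
    (hv : orient a b v = 0) (hw : orient a b w = 0) : orient a b x = 0 := by
  obtain ⟨t, -, -, ht⟩ := h.orient_eq
  rw [ht, hv, hw]; ring

theorem not_sbtw_corner {d a b v w : ℝ × ℝ} (h : 0 < orient d a b)
    (hv₁ : 0 ≤ orient a b v) (hw₁ : 0 ≤ orient a b w)
    (hv₂ : 0 ≤ orient d a v) (hw₂ : 0 ≤ orient d a w) : ¬ Sbtw ℝ v a w := by
  intro hs
  have hva : v = a := by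
    refine eq_of_orient_eq_zero h ?_ ?_
    · by_contra hne
      have := hs.orient_pos hv₁ hw₁ (Or.inl (lt_of_le_of_ne hv₁ (Ne.symm hne)))
      simp at this
    · by_contra hne
      have := hs.orient_pos hv₂ hw₂ (Or.inl (lt_of_le_of_ne hv₂ (Ne.symm hne)))
      simp at this
  exact hs.ne_left hva.symm

theorem sbtw_cases_of_orient_eq_zero {a b c : ℝ × ℝ} (hab : a ≠ b) (hbc : b ≠ c) (hca : c ≠ a)
    (h : orient a b c = 0) : Sbtw ℝ a b c ∨ Sbtw ℝ b c a ∨ Sbtw ℝ c a b := by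
  have hcol : Collinear ℝ {a, b, c} := by
    rw [collinear_iff_of_mem (p₀ := a) (by simp)]
    refine ⟨b - a, ?_⟩
    have hx : b.1 - a.1 ≠ 0 ∨ b.2 - a.2 ≠ 0 := by
      by_contra! hcon
      exact hab (Prod.ext (by linarith [hcon.1]) (by linarith [hcon.2]))
    intro p hp
    simp only [Set.mem_insert_iff, Set.mem_singleton_iff] at hp
    rcases hp with rfl | rfl | rfl
    · exact ⟨0, by simp⟩
    · exact ⟨1, by simp⟩
    · simp only [orient] at h
      rcases hx with hx | hx
      · refine ⟨(p.1 - a.1) / (b.1 - a.1), Prod.ext ?_ ?_⟩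
        · simp; field_simp; ring
        · simp; field_simp; linarith
      · refine ⟨(p.2 - a.2) / (b.2 - a.2), Prod.ext ?_ ?_⟩
        · simp; field_simp; linarith
        · simp; field_simp; ring
  rcases hcol.wbtw_or_wbtw_or_wbtw with h | h | h
  · exact Or.inl ⟨h, hab.symm, hbc⟩
  · exact Or.inr (Or.inl ⟨h, hbc.symm, hca⟩)
  · exact Or.inr (Or.inr ⟨h, hca.symm, hab⟩)

/-! ### Blocked finite sets -/

/-- Two distinct points of `X` have the same colour exactly when a point of `X` lies strictly
between them. -/
def FinBlocked {κ : Type*} (X : Finset (ℝ × ℝ)) (c : ℝ × ℝ → κ) : Prop :=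
  ∀ v ∈ X, ∀ w ∈ X, v ≠ w → (c v = c w ↔ ∃ x ∈ X, Sbtw ℝ v x w)

namespace FinBlocked

variable {κ : Type*} {X : Finset (ℝ × ℝ)} {c : ℝ × ℝ → κ}

theorem color_eq (h : FinBlocked X c) {v x w : ℝ × ℝ} (hv : v ∈ X) (hx : x ∈ X) (hw : w ∈ X)
    (hs : Sbtw ℝ v x w) : c v = c w :=
  (h v hv w hw hs.left_ne_right).2 ⟨x, hx, hs⟩

theorem exists_blocker (h : FinBlocked X c) {v w : ℝ × ℝ} (hv : v ∈ X) (hw : w ∈ X)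
    (hne : v ≠ w) (hc : c v = c w) : ∃ x ∈ X, Sbtw ℝ v x w :=
  (h v hv w hw hne).1 hc

theorem mono (h : FinBlocked X c) {Y : Finset (ℝ × ℝ)} (hYX : Y ⊆ X)
    (hY : ∀ v ∈ Y, ∀ w ∈ Y, ∀ x ∈ X, Sbtw ℝ v x w → x ∈ Y) : FinBlocked Y c := by
  intro v hv w hw hne
  rw [h v (hYX hv) w (hYX hw) hne]
  exact ⟨fun ⟨x, hx, hs⟩ => ⟨x, hY v hv w hw x hx hs, hs⟩, fun ⟨x, hx, hs⟩ => ⟨x, hYX hx, hs⟩⟩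

/-- A line contains at most three points of a blocked set. -/
theorem not_four_collinear (h : FinBlocked X c) {y x z w : ℝ × ℝ} (hy : y ∈ X) (hx : x ∈ X)
    (hz : z ∈ X) (hw : w ∈ X) (h₁ : Sbtw ℝ y x z) (h₂ : Sbtw ℝ x z w) : False := by
  classical
  obtain ⟨z', hz', hmin⟩ := (X.filter fun q => Sbtw ℝ x q w).exists_min_image (fun q => dist q w)
    ⟨z, Finset.mem_filter.2 ⟨hz, h₂⟩⟩
  obtain ⟨hz'X, hz's⟩ := Finset.mem_filter.1 hz'
  have hyxw : Sbtw ℝ y x w := h₁.trans_expand_left h₂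
  have hyxz' : Sbtw ℝ y x z' := hyxw.trans_right_left hz's
  have hc : c z' = c w := (h.color_eq hy hx hz'X hyxz').symm.trans (h.color_eq hy hx hw hyxw)
  obtain ⟨r, hr, hrs⟩ := h.exists_blocker hz'X hw hz's.ne_right hc
  have hle := hmin r (Finset.mem_filter.2 ⟨hr, hz's.trans_right hrs⟩)
  obtain ⟨⟨t, ⟨h0, h1⟩, rfl⟩, hne⟩ := sbtw_iff_mem_image_Ioo_and_ne.1 hrs
  rw [dist_lineMap_right, Real.norm_of_nonneg (by linarith)] at hle
  nlinarith [dist_pos.2 hne]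

theorem blocker_unique (h : FinBlocked X c) {a x y b : ℝ × ℝ} (ha : a ∈ X) (hx : x ∈ X)
    (hy : y ∈ X) (hb : b ∈ X) (h₁ : Sbtw ℝ a x b) (h₂ : Sbtw ℝ a y b) : x = y := by
  have key : ∀ {x y : ℝ × ℝ}, x ∈ X → y ∈ X → Sbtw ℝ a x b → Sbtw ℝ a y b → x ≠ y →
      ¬ Wbtw ℝ a x y := fun hx hy h₁ h₂ hne hw =>
    have hs : Sbtw ℝ a _ _ := ⟨hw, h₁.ne_left, hne⟩
    h.not_four_collinear ha hx hy hb hs (h₂.trans_left_right hs)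
  by_contra hne
  have hray := h₁.wbtw.sameRay_vsub_left.trans h₂.wbtw.sameRay_vsub_left.symm
    fun h0 => absurd (vsub_eq_zero_iff_eq.1 h0) h₁.left_ne_right.symm
  rcases wbtw_total_of_sameRay_vsub_left hray with hw | hw
  · exact key hx hy h₁ h₂ hne hw
  · exact key hy hx h₂ h₁ (Ne.symm hne) hw

/-- Three distinct points of the same colour are not collinear. -/
theorem orient_ne_zero (h : FinBlocked X c) {u v w : ℝ × ℝ} (hu : u ∈ X) (hv : v ∈ X)
    (hw : w ∈ X) (huv : u ≠ v) (hvw : v ≠ w) (hwu : w ≠ u) (h₁ : c u = c v) (h₂ : c v = c w) :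
    orient u v w ≠ 0 := by
  have key : ∀ {p q r : ℝ × ℝ}, p ∈ X → q ∈ X → r ∈ X → c p = c q → Sbtw ℝ p q r → False := by
    intro p q r hp hq hr hc hs
    obtain ⟨x, hx, hxs⟩ := h.exists_blocker hp hq hs.left_ne hc
    exact h.not_four_collinear hp hx hq hr hxs (hs.trans_left_right hxs)
  intro h0
  rcases sbtw_cases_of_orient_eq_zero huv hvw hwu h0 with hs | hs | hs
  · exact key hu hv hw h₁ hs
  · exact key hv hw hu h₂ hs
  · exact key hw hu hv (h₂.symm.trans h₁.symm) hs

end FinBlocked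

/-- A finite planar set with three noncollinear points has a triangle whose closed hull contains
no other point of the set. -/
theorem exists_empty_triangle {S : Finset (ℝ × ℝ)} {u v w : ℝ × ℝ} (hu : u ∈ S) (hv : v ∈ S)
    (hw : w ∈ S) (h : orient u v w ≠ 0) :
    ∃ u ∈ S, ∃ v ∈ S, ∃ w ∈ S, 0 < orient u v w ∧
      ∀ p ∈ S, 0 ≤ orient u v p → 0 ≤ orient v w p → 0 ≤ orient w u p →
        p = u ∨ p = v ∨ p = w := by
  classical
  have hne : ((S ×ˢ S ×ˢ S).filter fun t => 0 < orient t.1 t.2.1 t.2.2).Nonempty := by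
    rcases lt_or_gt_of_ne h with h | h
    · exact ⟨(v, u, w), by simp [hu, hv, hw, orient_swap u v w, h]⟩
    · exact ⟨(u, v, w), by simp [hu, hv, hw, h]⟩
  obtain ⟨⟨u, v, w⟩, ht, hmin⟩ := Finset.exists_min_image _ (fun t => orient t.1 t.2.1 t.2.2) hne
  simp only [Finset.mem_filter, Finset.mem_product] at ht hmin
  obtain ⟨⟨hu, hv, hw⟩, hpos⟩ := ht
  refine ⟨u, hu, v, hv, w, hw, hpos, fun p hp h₁ h₂ h₃ => ?_⟩
  have hsum := orient_add_orient_add_orient u v w p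
  have k₁ : orient u v p = 0 ∨ orient u v w ≤ orient u v p :=
    h₁.eq_or_lt.imp Eq.symm fun hlt => hmin (u, v, p) ⟨⟨hu, hv, hp⟩, hlt⟩
  have k₂ : orient v w p = 0 ∨ orient u v w ≤ orient v w p :=
    h₂.eq_or_lt.imp Eq.symm fun hlt => hmin (v, w, p) ⟨⟨hv, hw, hp⟩, hlt⟩
  have k₃ : orient w u p = 0 ∨ orient u v w ≤ orient w u p :=
    h₃.eq_or_lt.imp Eq.symm fun hlt => hmin (w, u, p) ⟨⟨hw, hu, hp⟩, hlt⟩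
  have e₁ := orient_rotate u v w
  have e₂ := orient_rotate w u v
  by_cases z₁ : orient u v p = 0
  · by_cases z₂ : orient v w p = 0
    · exact Or.inr (Or.inl (eq_of_orient_eq_zero hpos z₂ z₁))
    · have z₃ : orient w u p = 0 := by
        rcases k₂ with k | k
        · exact absurd k z₂
        · linarith
      exact Or.inl (eq_of_orient_eq_zero (by linarith) z₁ z₃)
  · have z₂ : orient v w p = 0 := by
      rcases k₁ with k | k
      · exact absurd k z₁
      · linarith
    have z₃ : orient w u p = 0 := by
      rcases k₁ with k | k
      · exact absurd k z₁
      · linarith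
    exact Or.inr (Or.inr (eq_of_orient_eq_zero (by linarith) z₃ z₂))

namespace FinBlocked

variable {κ : Type*} [DecidableEq κ] {X : Finset (ℝ × ℝ)} {c : ℝ × ℝ → κ}

/-- A blocked set with at most two colours is collinear. -/
theorem collinear_of_two_colors (h : FinBlocked X c) (hcard : (X.image c).card ≤ 2)
    {u v w : ℝ × ℝ} (hu : u ∈ X) (hv : v ∈ X) (hw : w ∈ X) : orient u v w = 0 := by
  by_contra hne
  obtain ⟨u, hu, v, hv, w, hw, hpos, hemp⟩ := exists_empty_triangle hu hv hw hne
  have e₁ := orient_rotate u v w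
  have e₂ := orient_rotate w u v
  have key : ∀ {p q : ℝ × ℝ}, p ∈ ({u, v, w} : Finset _) → q ∈ ({u, v, w} : Finset _) →
      p ≠ q → c p ≠ c q := by
    intro p q hp hq hpq hc
    have hsub : ∀ {p}, p ∈ ({u, v, w} : Finset (ℝ × ℝ)) →
        p ∈ X ∧ 0 ≤ orient u v p ∧ 0 ≤ orient v w p ∧ 0 ≤ orient w u p := by
      intro p hp
      simp only [Finset.mem_insert, Finset.mem_singleton] at hp
      rcases hp with rfl | rfl | rfl <;> simp [*] <;> linarith
    obtain ⟨hpX, hp₁, hp₂, hp₃⟩ := hsub hp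
    obtain ⟨hqX, hq₁, hq₂, hq₃⟩ := hsub hq
    obtain ⟨x, hx, hs⟩ := h.exists_blocker hpX hqX hpq hc
    rcases hemp x hx (hs.orient_nonneg hp₁ hq₁) (hs.orient_nonneg hp₂ hq₂)
      (hs.orient_nonneg hp₃ hq₃) with rfl | rfl | rfl
    · exact not_sbtw_corner (by linarith) hp₁ hq₁ hp₃ hq₃ hs
    · exact not_sbtw_corner (by linarith) hp₂ hq₂ hp₁ hq₁ hs
    · exact not_sbtw_corner (by linarith) hp₃ hq₃ hp₂ hq₂ hs
  have huv : u ≠ v := by rintro rfl; simp at hpos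
  have hvw : v ≠ w := by rintro rfl; simp at hpos
  have huw : u ≠ w := by rintro rfl; simp at hpos
  have : 2 < (X.image c).card := Finset.two_lt_card.2
    ⟨c u, Finset.mem_image_of_mem c hu, c v, Finset.mem_image_of_mem c hv, c w,
      Finset.mem_image_of_mem c hw, key (by simp) (by simp) huv, key (by simp) (by simp) huw,
      key (by simp) (by simp) hvw⟩
  omega

/-- In a blocked set with at most three colours each colour occurs at most twice. -/
theorem not_three_of_three_colors (h : FinBlocked X c) (hcard : (X.image c).card ≤ 3)
    {u v w : ℝ × ℝ} (hu : u ∈ X) (hv : v ∈ X) (hw : w ∈ X) (huv : u ≠ v) (hvw : v ≠ w)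
    (hwu : w ≠ u) (h₁ : c u = c v) (h₂ : c v = c w) : False := by
  have hne := h.orient_ne_zero hu hv hw huv hvw hwu h₁ h₂
  obtain ⟨γ, hγ⟩ : ∃ γ, c v = γ := ⟨_, rfl⟩
  obtain ⟨u, hu, v, hv, w, hw, hpos, hemp⟩ := exists_empty_triangle
    (S := X.filter fun p => c p = γ) (Finset.mem_filter.2 ⟨hu, h₁.trans hγ⟩)
    (Finset.mem_filter.2 ⟨hv, hγ⟩) (Finset.mem_filter.2 ⟨hw, h₂.symm.trans hγ⟩) hne
  clear hne
  obtain ⟨hu, hcu⟩ := Finset.mem_filter.1 hu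
  obtain ⟨hv, hcv⟩ := Finset.mem_filter.1 hv
  obtain ⟨hw, hcw⟩ := Finset.mem_filter.1 hw
  have e₁ := orient_rotate u v w
  have e₂ := orient_rotate w u v
  let Y := X.filter fun p =>
    c p ≠ γ ∧ 0 ≤ orient u v p ∧ 0 ≤ orient v w p ∧ 0 ≤ orient w u p
  have hclosed : ∀ {p q x : ℝ × ℝ}, (0 ≤ orient u v p ∧ 0 ≤ orient v w p ∧ 0 ≤ orient w u p) →
      (0 ≤ orient u v q ∧ 0 ≤ orient v w q ∧ 0 ≤ orient w u q) → x ∈ X → Sbtw ℝ p x q →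
      x ∈ Y := by
    rintro p q x ⟨hp₁, hp₂, hp₃⟩ ⟨hq₁, hq₂, hq₃⟩ hx hs
    have hx₁ := hs.orient_nonneg hp₁ hq₁
    have hx₂ := hs.orient_nonneg hp₂ hq₂
    have hx₃ := hs.orient_nonneg hp₃ hq₃
    refine Finset.mem_filter.2 ⟨hx, fun hc => ?_, hx₁, hx₂, hx₃⟩
    rcases hemp x (Finset.mem_filter.2 ⟨hx, hc⟩) hx₁ hx₂ hx₃ with rfl | rfl | rfl
    · exact not_sbtw_corner (by linarith) hp₁ hq₁ hp₃ hq₃ hs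
    · exact not_sbtw_corner (by linarith) hp₂ hq₂ hp₁ hq₁ hs
    · exact not_sbtw_corner (by linarith) hp₃ hq₃ hp₂ hq₂ hs
  have hY : FinBlocked Y c := h.mono (Finset.filter_subset _ _) fun p hp q hq x hx hs =>
    hclosed (Finset.mem_filter.1 hp).2.2 (Finset.mem_filter.1 hq).2.2 hx hs
  have hYcard : (Y.image c).card ≤ 2 := by
    have hsub : Y.image c ⊆ (X.image c).erase γ := by
      intro k hk
      obtain ⟨p, hp, rfl⟩ := Finset.mem_image.1 hk
      obtain ⟨hpX, hpc, -⟩ := Finset.mem_filter.1 hp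
      exact Finset.mem_erase.2 ⟨hpc, Finset.mem_image_of_mem c hpX⟩
    have hγX : γ ∈ X.image c := hcu ▸ Finset.mem_image_of_mem c hu
    have := Finset.card_le_card hsub
    rw [Finset.card_erase_of_mem hγX] at this
    omega
  have huT : 0 ≤ orient u v u ∧ 0 ≤ orient v w u ∧ 0 ≤ orient w u u := by
    simp; linarith
  have hvT : 0 ≤ orient u v v ∧ 0 ≤ orient v w v ∧ 0 ≤ orient w u v := by
    simp; linarith
  have hwT : 0 ≤ orient u v w ∧ 0 ≤ orient v w w ∧ 0 ≤ orient w u w := by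
    simp; linarith
  have huv : u ≠ v := by rintro rfl; simp at hpos
  have hvw : v ≠ w := by rintro rfl; simp at hpos
  have hwu : w ≠ u := by rintro rfl; simp at hpos
  obtain ⟨x, hx, hxs⟩ := h.exists_blocker hu hv huv (hcu.trans hcv.symm)
  obtain ⟨y, hy, hys⟩ := h.exists_blocker hv hw hvw (hcv.trans hcw.symm)
  obtain ⟨z, hz, hzs⟩ := h.exists_blocker hw hu hwu (hcw.trans hcu.symm)
  have h0 := hY.collinear_of_two_colors hYcard (hclosed huT hvT hx hxs) (hclosed hvT hwT hy hys)
    (hclosed hwT huT hz hzs)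
  obtain ⟨r, hr0, hr1, hr⟩ := hxs.orient_eq
  obtain ⟨s, hs0, hs1, hs⟩ := hys.orient_eq
  obtain ⟨t, ht0, ht1, ht⟩ := hzs.orient_eq
  have : orient x y z = ((1 - r) * (1 - s) * (1 - t) + r * s * t) * orient u v w := by
    have k₁ : orient w x v = (1 - r) * orient u v w := by
      rw [← orient_rotate w x v, ← orient_rotate x v w, hr, e₁]; simp
    have k₂ : orient u x v = 0 := by
      rw [← orient_rotate u x v, ← orient_rotate x v u, hr]; simp
    have k₃ : orient u x w = r * orient u v w := by
      rw [← orient_rotate u x w, ← orient_rotate x w u, hr, e₂]; simp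
    rw [ht, orient_rotate w x y, orient_rotate u x y, hs, hs, k₁, k₂, k₃]
    simp only [orient_self_left]
    ring
  have h1 : 0 < (1 - r) * (1 - s) * (1 - t) :=
    mul_pos (mul_pos (by linarith) (by linarith)) (by linarith)
  have h2 : 0 < r * s * t := by positivity
  rw [this] at h0
  exact absurd h0 (by positivity)

end FinBlocked

/-! ### Convex quadrilaterals -/

/-- `a b c d` are the vertices of a convex quadrilateral in counterclockwise order. -/
structure ConvexQuad (a b c d : ℝ × ℝ) : Prop where
  abc : 0 < orient a b c
  bcd : 0 < orient b c d
  cda : 0 < orient c d a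
  dab : 0 < orient d a b

/-- `p` lies in the closed region bounded by the convex quadrilateral `a b c d`. -/
structure InQuad (a b c d p : ℝ × ℝ) : Prop where
  ab : 0 ≤ orient a b p
  bc : 0 ≤ orient b c p
  cd : 0 ≤ orient c d p
  da : 0 ≤ orient d a p

/-- The only points of `R` in the closed quadrilateral `a b c d` are its vertices. -/
def EmptyQuad (R : Finset (ℝ × ℝ)) (a b c d : ℝ × ℝ) : Prop :=
  ∀ p ∈ R, InQuad a b c d p → p = a ∨ p = b ∨ p = c ∨ p = d

theorem ConvexQuad.rotate {a b c d : ℝ × ℝ} (h : ConvexQuad a b c d) : ConvexQuad b c d a :=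
  ⟨h.bcd, h.cda, h.dab, h.abc⟩

theorem InQuad.rotate {a b c d p : ℝ × ℝ} (h : InQuad a b c d p) : InQuad b c d a p :=
  ⟨h.bc, h.cd, h.da, h.ab⟩

theorem ConvexQuad.inQuad_left {a b c d : ℝ × ℝ} (h : ConvexQuad a b c d) :
    InQuad a b c d a := by
  refine ⟨?_, ?_, ?_, ?_⟩
  · simp
  · rw [orient_rotate]; exact h.abc.le
  · exact h.cda.le
  · simp

theorem InQuad.sbtw {a b c d v x w : ℝ × ℝ} (hv : InQuad a b c d v) (hw : InQuad a b c d w)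
    (h : Sbtw ℝ v x w) : InQuad a b c d x :=
  ⟨h.orient_nonneg hv.ab hw.ab, h.orient_nonneg hv.bc hw.bc, h.orient_nonneg hv.cd hw.cd,
    h.orient_nonneg hv.da hw.da⟩

theorem ConvexQuad.orient_side {a b c d p : ℝ × ℝ} (h : ConvexQuad a b c d) (hp : Sbtw ℝ a p b) :
    orient a b p = 0 ∧ 0 < orient b c p ∧ 0 < orient c d p ∧ 0 < orient d a p ∧
      0 < orient c a p ∧ 0 < orient b d p := by
  have e₁ := orient_rotate a b c
  have e₂ := orient_rotate b c d
  have e₃ := orient_rotate d a b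
  have h₁ := h.abc
  have h₂ := h.bcd
  have h₃ := h.cda
  have h₄ := h.dab
  have e₄ := orient_rotate c a b
  have e₅ := orient_rotate b d a
  refine ⟨hp.orient_eq_zero (by simp) (by simp), hp.orient_pos ?_ ?_ ?_, hp.orient_pos ?_ ?_ ?_,
    hp.orient_pos ?_ ?_ ?_, hp.orient_pos ?_ ?_ ?_, hp.orient_pos ?_ ?_ ?_⟩ <;>
    first | (simp; done) | linarith | (left; linarith) | (right; linarith)

theorem ConvexQuad.orient_diagonal {a b c d p : ℝ × ℝ} (h : ConvexQuad a b c d)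
    (hp : Sbtw ℝ a p c) :
    0 < orient a b p ∧ 0 < orient b c p ∧ 0 < orient c d p ∧ 0 < orient d a p ∧
      orient c a p = 0 := by
  have e₁ := orient_rotate a b c
  have e₂ := orient_rotate c d a
  have h₁ := h.abc
  have h₃ := h.cda
  refine ⟨hp.orient_pos ?_ ?_ ?_, hp.orient_pos ?_ ?_ ?_, hp.orient_pos ?_ ?_ ?_,
    hp.orient_pos ?_ ?_ ?_, hp.orient_eq_zero (by simp) (by simp)⟩ <;>
    first | (simp; done) | linarith | (left; linarith) | (right; linarith)

/-- A point of a convex quadrilateral on the line of a side and distinct from the corners lies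
strictly inside that side. -/
theorem ConvexQuad.sbtw_of_orient_eq_zero {a b c d p : ℝ × ℝ} (h : ConvexQuad a b c d)
    (hp : InQuad a b c d p) (h0 : orient a b p = 0) (hpa : p ≠ a) (hpb : p ≠ b) :
    Sbtw ℝ a p b := by
  have hab : a ≠ b := by
    rintro rfl
    simpa using h.abc
  have e₁ := orient_rotate a b c
  have h₁ := h.abc
  have h₄ := h.dab
  rcases sbtw_cases_of_orient_eq_zero hab hpb.symm hpa h0 with hs | hs | hs
  · have := hs.orient_pos (a := b) (b := c) (by linarith) hp.bc (Or.inl (by linarith))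
    simp at this
  · exact hs.symm
  · have := hs.orient_pos (a := d) (b := a) hp.da h₄.le (Or.inr h₄)
    simp at this

section Coloring

variable {κ : Type*} [DecidableEq κ] {Q : Finset (ℝ × ℝ)} {c : ℝ × ℝ → κ}

theorem FinBlocked.card_filter_le_two (h : FinBlocked Q c) (hcard : (Q.image c).card ≤ 3)
    (γ : κ) : (Q.filter fun p => c p = γ).card ≤ 2 := by
  by_contra! hlt
  obtain ⟨u, hu, v, hv, w, hw, huv, huw, hvw⟩ := Finset.two_lt_card.1 hlt
  simp only [Finset.mem_filter] at hu hv hw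
  exact h.not_three_of_three_colors hcard hu.1 hv.1 hw.1 huv hvw huw.symm
    (hu.2.trans hv.2.symm) (hv.2.trans hw.2.symm)

theorem FinBlocked.card_le_six (h : FinBlocked Q c) (hcard : (Q.image c).card ≤ 3) :
    Q.card ≤ 6 := by
  have := Finset.card_le_mul_card_image (f := c) Q 2 fun γ _ => h.card_filter_le_two hcard γ
  omega

theorem FinBlocked.exists_partner (h : FinBlocked Q c) (hcard : (Q.image c).card ≤ 3)
    (h6 : 6 ≤ Q.card) {u : ℝ × ℝ} (hu : u ∈ Q) : ∃ v ∈ Q, u ≠ v ∧ c u = c v := by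
  by_contra! hno
  have hsub : (Q.erase u).image c ⊆ (Q.image c).erase (c u) := by
    intro k hk
    obtain ⟨p, hp, rfl⟩ := Finset.mem_image.1 hk
    obtain ⟨hpu, hpQ⟩ := Finset.mem_erase.1 hp
    exact Finset.mem_erase.2 ⟨(hno p hpQ hpu.symm).symm, Finset.mem_image_of_mem c hpQ⟩
  have h₁ := Finset.card_le_card hsub
  rw [Finset.card_erase_of_mem (Finset.mem_image_of_mem c hu)] at h₁
  have h₂ := Finset.card_le_mul_card_image (f := c) (Q.erase u) 2 fun γ _ =>
    (Finset.card_le_card (Finset.filter_subset_filter _ (Finset.erase_subset u Q))).trans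
      (h.card_filter_le_two hcard γ)
  rw [Finset.card_erase_of_mem hu] at h₂
  omega

end Coloring

/-- In a `4`-blocked set, the diagonals of an empty monochromatic convex quadrilateral have a
common blocker, which also blocks the two pairs of blockers of opposite sides. -/
theorem FinBlocked.empty_quad {X : Finset (ℝ × ℝ)} {col : ℝ × ℝ → Fin 4} (h : FinBlocked X col)
    {γ : Fin 4} {a b c d : ℝ × ℝ} (ha : a ∈ X.filter fun p => col p = γ)
    (hb : b ∈ X.filter fun p => col p = γ) (hc : c ∈ X.filter fun p => col p = γ)
    (hd : d ∈ X.filter fun p => col p = γ) (hq : ConvexQuad a b c d)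
    (hemp : EmptyQuad (X.filter fun p => col p = γ) a b c d) :
    ∃ x ∈ X, ∃ p ∈ X, ∃ q ∈ X, ∃ r ∈ X, ∃ s ∈ X, Sbtw ℝ a x c ∧ Sbtw ℝ b x d ∧
      Sbtw ℝ a p b ∧ Sbtw ℝ b q c ∧ Sbtw ℝ c r d ∧ Sbtw ℝ d s a ∧
      Sbtw ℝ p x r ∧ Sbtw ℝ q x s := by
  classical
  obtain ⟨Q, hQ⟩ : ∃ Q : Finset (ℝ × ℝ), ∀ p, p ∈ Q ↔ p ∈ X ∧ col p ≠ γ ∧ InQuad a b c d p :=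
    ⟨X.filter fun p => col p ≠ γ ∧ InQuad a b c d p, fun p => by simp⟩
  obtain ⟨haX, hca⟩ := Finset.mem_filter.1 ha
  obtain ⟨hbX, hcb⟩ := Finset.mem_filter.1 hb
  obtain ⟨hcX, hcc⟩ := Finset.mem_filter.1 hc
  obtain ⟨hdX, hcd⟩ := Finset.mem_filter.1 hd
  have haQ := hq.inQuad_left
  have hbQ := hq.rotate.inQuad_left.rotate.rotate.rotate
  have hcQ := hq.rotate.rotate.inQuad_left.rotate.rotate
  have hdQ := hq.rotate.rotate.rotate.inQuad_left.rotate
  have hclosed : ∀ {v x w}, InQuad a b c d v → InQuad a b c d w → x ∈ X → Sbtw ℝ v x w →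
      x ∈ Q := by
    intro v x w hv hw hx hs
    have hxQ := hv.sbtw hw hs
    refine (hQ x).2 ⟨hx, fun hcx => ?_, hxQ⟩
    rcases hemp x (Finset.mem_filter.2 ⟨hx, hcx⟩) hxQ with rfl | rfl | rfl | rfl
    · exact not_sbtw_corner hq.dab hv.ab hw.ab hv.da hw.da hs
    · exact not_sbtw_corner hq.abc hv.bc hw.bc hv.ab hw.ab hs
    · exact not_sbtw_corner hq.bcd hv.cd hw.cd hv.bc hw.bc hs
    · exact not_sbtw_corner hq.cda hv.da hw.da hv.cd hw.cd hs
  have hQX : Q ⊆ X := fun p hp => ((hQ p).1 hp).1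
  have hQin : ∀ {p}, p ∈ Q → InQuad a b c d p := fun hp => ((hQ _).1 hp).2.2
  have hQcol : ∀ {p}, p ∈ Q → col p ≠ γ := fun hp => ((hQ _).1 hp).2.1
  have hQb : FinBlocked Q col := h.mono hQX fun v hv w hw x hx hs =>
    hclosed (hQin hv) (hQin hw) hx hs
  have hQcard : (Q.image col).card ≤ 3 := by
    have hsub : Q.image col ⊆ Finset.univ.erase γ := by
      intro k hk
      obtain ⟨p, hp, rfl⟩ := Finset.mem_image.1 hk
      exact Finset.mem_erase.2 ⟨hQcol hp, Finset.mem_univ _⟩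
    simpa using Finset.card_le_card hsub
  have hab : a ≠ b := by rintro rfl; simpa using hq.abc
  have hbc : b ≠ c := by rintro rfl; simpa using hq.abc
  have hcd' : c ≠ d := by rintro rfl; simpa using hq.bcd
  have hda : d ≠ a := by rintro rfl; simpa using hq.cda
  have hac : a ≠ c := by rintro rfl; simpa using hq.abc
  have hbd : b ≠ d := by rintro rfl; simpa using hq.bcd
  obtain ⟨p, hpX, hp⟩ := h.exists_blocker haX hbX hab (hca.trans hcb.symm)
  obtain ⟨q, hqX, hqs⟩ := h.exists_blocker hbX hcX hbc (hcb.trans hcc.symm)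
  obtain ⟨r, hrX, hr⟩ := h.exists_blocker hcX hdX hcd' (hcc.trans hcd.symm)
  obtain ⟨s, hsX, hs⟩ := h.exists_blocker hdX haX hda (hcd.trans hca.symm)
  obtain ⟨u, huX, hu⟩ := h.exists_blocker haX hcX hac (hca.trans hcc.symm)
  obtain ⟨v, hvX, hv⟩ := h.exists_blocker hbX hdX hbd (hcb.trans hcd.symm)
  have hpQ := hclosed haQ hbQ hpX hp
  have hqQ := hclosed hbQ hcQ hqX hqs
  have hrQ := hclosed hcQ hdQ hrX hr
  have hsQ := hclosed hdQ haQ hsX hs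
  have huQ := hclosed haQ hcQ huX hu
  have hvQ := hclosed hbQ hdQ hvX hv
  obtain ⟨p₁, p₂, p₃, p₄, p₅, p₆⟩ := hq.orient_side hp
  obtain ⟨q₂, q₃, q₄, q₁, q₅, q₆⟩ := hq.rotate.orient_side hqs
  obtain ⟨r₃, r₄, r₁, r₂, r₅, r₆⟩ := hq.rotate.rotate.orient_side hr
  obtain ⟨s₄, s₁, s₂, s₃, s₅, s₆⟩ := hq.rotate.rotate.rotate.orient_side hs
  obtain ⟨u₁, u₂, u₃, u₄, u₅⟩ := hq.orient_diagonal hu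
  obtain ⟨v₂, v₃, v₄, v₁, v₅⟩ := hq.rotate.orient_diagonal hv
  -- Points strictly inside the quadrilateral
  let Inn : ℝ × ℝ → Prop := fun t =>
    0 < orient a b t ∧ 0 < orient b c t ∧ 0 < orient c d t ∧ 0 < orient d a t
  have hInn : ∀ {t w y}, Inn t → InQuad a b c d w → Sbtw ℝ t y w → Inn y := by
    rintro t w y ⟨t₁, t₂, t₃, t₄⟩ hw hs
    exact ⟨hs.orient_pos t₁.le hw.ab (Or.inl t₁), hs.orient_pos t₂.le hw.bc (Or.inl t₂),
      hs.orient_pos t₃.le hw.cd (Or.inl t₃), hs.orient_pos t₄.le hw.da (Or.inl t₄)⟩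
  have huI : Inn u := ⟨u₁, u₂, u₃, u₄⟩
  have hvI : Inn v := ⟨v₁, v₂, v₃, v₄⟩
  have hpI : ¬ Inn p := fun hI => hI.1.ne' p₁
  have hqI : ¬ Inn q := fun hI => hI.2.1.ne' q₂
  have hrI : ¬ Inn r := fun hI => hI.2.2.1.ne' r₃
  have hsI : ¬ Inn s := fun hI => hI.2.2.2.ne' s₄
  have hpq : p ≠ q := by rintro rfl; linarith
  have hpr : p ≠ r := by rintro rfl; linarith
  have hps : p ≠ s := by rintro rfl; linarith
  have hqr : q ≠ r := by rintro rfl; linarith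
  have hqs' : q ≠ s := by rintro rfl; linarith
  have hrs : r ≠ s := by rintro rfl; linarith
  have hcorner : ∀ {t e}, t ∈ Q → col e = γ → t ≠ e := by
    rintro t e ht he rfl
    exact hQcol ht he
  have hbdry : ∀ {t}, t ∈ Q → ¬ Inn t → t = p ∨ t = q ∨ t = r ∨ t = s := by
    intro t ht hI
    have htin := hQin ht
    by_contra! hcon
    refine hI ⟨htin.ab.lt_of_ne fun h0 => ?_, htin.bc.lt_of_ne fun h0 => ?_,
      htin.cd.lt_of_ne fun h0 => ?_, htin.da.lt_of_ne fun h0 => ?_⟩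
    · exact hcon.1 (h.blocker_unique haX (hQX ht) hpX hbX (hq.sbtw_of_orient_eq_zero htin h0.symm
        (hcorner ht hca) (hcorner ht hcb)) hp)
    · exact hcon.2.1 (h.blocker_unique hbX (hQX ht) hqX hcX (hq.rotate.sbtw_of_orient_eq_zero
        htin.rotate h0.symm (hcorner ht hcb) (hcorner ht hcc)) hqs)
    · exact hcon.2.2.1 (h.blocker_unique hcX (hQX ht) hrX hdX
        (hq.rotate.rotate.sbtw_of_orient_eq_zero htin.rotate.rotate h0.symm (hcorner ht hcc)
          (hcorner ht hcd)) hr)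
    · exact hcon.2.2.2 (h.blocker_unique hdX (hQX ht) hsX haX
        (hq.rotate.rotate.rotate.sbtw_of_orient_eq_zero htin.rotate.rotate.rotate h0.symm
          (hcorner ht hcd) (hcorner ht hca)) hs)
  have hinner : ∀ {t}, t ∈ Q → Inn t → t = u := by
    intro t ht hI
    by_contra htu
    have hne : ∀ {y z}, Inn y → ¬ Inn z → z ≠ y := by
      rintro y z hy hz rfl
      exact hz hy
    have hS : ({p, q, r, s, u, t} : Finset (ℝ × ℝ)).card = 6 := by
      have htu' := Ne.symm htu
      have k₁ := hne huI hpI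
      have k₂ := hne huI hqI
      have k₃ := hne huI hrI
      have k₄ := hne huI hsI
      have l₁ := hne hI hpI
      have l₂ := hne hI hqI
      have l₃ := hne hI hrI
      have l₄ := hne hI hsI
      simp [Finset.card_insert_of_notMem, *]
    have hSQ : ({p, q, r, s, u, t} : Finset (ℝ × ℝ)) ⊆ Q := by
      intro y hy
      simp only [Finset.mem_insert, Finset.mem_singleton] at hy
      rcases hy with rfl | rfl | rfl | rfl | rfl | rfl <;> assumption
    have hQS := Finset.eq_of_subset_of_card_le hSQ (hS ▸ hQb.card_le_six hQcard)
    have h6 : 6 ≤ Q.card := hS ▸ Finset.card_le_card hSQ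
    have hblk : ∀ {y}, y ∈ Q → Inn y → ∃ y' ∈ Q, ∃ z, (z = u ∨ z = t) ∧ z ≠ y ∧
        Sbtw ℝ y z y' := by
      intro y hy hyI
      obtain ⟨y', hy', hne', hcol⟩ := hQb.exists_partner hQcard h6 hy
      obtain ⟨z, hz, hzs⟩ := hQb.exists_blocker hy hy' hne' hcol
      have hzI := hInn hyI (hQin hy') hzs
      refine ⟨y', hy', z, ?_, hzs.ne_left, hzs⟩
      rw [← hQS] at hz
      simp only [Finset.mem_insert, Finset.mem_singleton] at hz
      rcases hz with rfl | rfl | rfl | rfl | hz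
      · exact absurd hzI hpI
      · exact absurd hzI hqI
      · exact absurd hzI hrI
      · exact absurd hzI hsI
      · exact hz
    obtain ⟨u', hu', z, hz, hzu, hus⟩ := hblk huQ huI
    obtain rfl := hz.resolve_left hzu
    obtain ⟨t', ht', z', hz', hzt, hts⟩ := hblk ht hI
    obtain rfl := hz'.resolve_right hzt
    exact hQb.not_four_collinear ht' huQ ht hu' hts.symm hus
  obtain rfl : v = u := hinner hvQ hvI
  have hmem : ∀ {y}, y ∈ Q → y = v ∨ y = p ∨ y = q ∨ y = r ∨ y = s := by
    intro y hy
    by_cases hI : Inn y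
    · exact Or.inl (hinner hy hI)
    · exact Or.inr (hbdry hy hI)
  have hcolv : ∀ {w}, w ∈ Q → ¬ Inn w → col v ≠ col w := by
    intro w hw hwI hcol
    obtain ⟨y, hy, hys⟩ := hQb.exists_blocker hvQ hw (fun e => hwI (e ▸ hvI)) hcol
    exact hys.ne_left (hinner hy (hInn hvI (hQin hw) hys))
  have hadj : ∀ {y z}, y ∈ Q → z ∈ Q → y ≠ z →
      (∀ w ∈ Q, w ≠ y → w ≠ z → ∃ i j, 0 < orient i j y ∧ 0 < orient i j z ∧ orient i j w = 0) →
      col y ≠ col z := by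
    intro y z hy hz hyz hw hcol
    obtain ⟨w, hwQ, hws⟩ := hQb.exists_blocker hy hz hyz hcol
    obtain ⟨i, j, hi, hj, h0⟩ := hw w hwQ hws.ne_left hws.ne_right
    exact (hws.orient_pos hi.le hj.le (Or.inl hi)).ne' h0
  have cpq : col p ≠ col q := hadj hpQ hqQ hpq fun w hw hwp hwq => by
    rcases hmem hw with rfl | rfl | rfl | rfl | rfl
    exacts [⟨c, a, p₅, q₆, u₅⟩, absurd rfl hwp, absurd rfl hwq, ⟨c, d, p₃, q₃, r₃⟩,
      ⟨d, a, p₄, q₄, s₄⟩]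
  have cqr : col q ≠ col r := hadj hqQ hrQ hqr fun w hw hwq hwr => by
    rcases hmem hw with rfl | rfl | rfl | rfl | rfl
    exacts [⟨d, b, q₅, r₆, v₅⟩, ⟨a, b, q₁, r₁, p₁⟩, absurd rfl hwq, absurd rfl hwr,
      ⟨d, a, q₄, r₄, s₄⟩]
  have crs : col r ≠ col s := hadj hrQ hsQ hrs fun w hw hwr hws => by
    rcases hmem hw with rfl | rfl | rfl | rfl | rfl
    exacts [⟨a, c, r₅, s₆, by rw [orient_swap, u₅, neg_zero]⟩, ⟨a, b, r₁, s₁, p₁⟩,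
      ⟨b, c, r₂, s₂, q₂⟩, absurd rfl hwr, absurd rfl hws]
  have cps : col p ≠ col s := hadj hpQ hsQ hps fun w hw hwp hws => by
    rcases hmem hw with rfl | rfl | rfl | rfl | rfl
    exacts [⟨b, d, p₆, s₅, by rw [orient_swap, v₅, neg_zero]⟩, absurd rfl hwp,
      ⟨b, c, p₂, s₂, q₂⟩, ⟨c, d, p₃, s₃, r₃⟩, absurd rfl hws]
  have hfour : ∀ x g y₁ y₂ z : Fin 4, x ≠ g → y₁ ≠ g → y₂ ≠ g → z ≠ g → x ≠ y₁ → x ≠ y₂ →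
      x ≠ z → y₁ ≠ z → y₂ ≠ z → y₁ = y₂ := by decide
  have cpr : col p = col r := hfour (col v) γ _ _ (col q) (hQcol hvQ) (hQcol hpQ) (hQcol hrQ)
    (hQcol hqQ) (hcolv hpQ hpI) (hcolv hrQ hrI) (hcolv hqQ hqI) cpq cqr.symm
  have cqs : col q = col s := hfour (col v) γ _ _ (col p) (hQcol hvQ) (hQcol hqQ) (hQcol hsQ)
    (hQcol hpQ) (hcolv hqQ hqI) (hcolv hsQ hsI) (hcolv hpQ hpI) cpq.symm cps.symm
  refine ⟨v, hvX, p, hpX, q, hqX, r, hrX, s, hsX, hu, hv, hp, hqs, hr, hs, ?_, ?_⟩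
  · obtain ⟨w, hw, hwS⟩ := hQb.exists_blocker hpQ hrQ hpr cpr
    rcases hmem hw with rfl | rfl | rfl | rfl | rfl
    · exact hwS
    · exact absurd rfl hwS.ne_left
    · exact absurd q₂ (hwS.orient_pos p₂.le r₂.le (Or.inl p₂)).ne'
    · exact absurd rfl hwS.ne_right
    · exact absurd s₄ (hwS.orient_pos p₄.le r₄.le (Or.inl p₄)).ne'
  · obtain ⟨w, hw, hwS⟩ := hQb.exists_blocker hqQ hsQ hqs' cqs
    rcases hmem hw with rfl | rfl | rfl | rfl | rfl
    · exact hwS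
    · exact absurd p₁ (hwS.orient_pos q₁.le s₁.le (Or.inl q₁)).ne'
    · exact absurd rfl hwS.ne_left
    · exact absurd r₃ (hwS.orient_pos q₃.le s₃.le (Or.inl q₃)).ne'
    · exact absurd rfl hwS.ne_right

/-- Two empty convex quadrilaterals cannot arise by flipping an empty triangle `e c d` across two
of its sides. -/
def NoDoubleFlip (R : Finset (ℝ × ℝ)) : Prop :=
  ∀ a ∈ R, ∀ b ∈ R, ∀ c ∈ R, ∀ d ∈ R, ∀ e ∈ R, ConvexQuad a e c d → ConvexQuad e b c d →
    EmptyQuad R a e c d → EmptyQuad R e b c d → False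

theorem FinBlocked.noDoubleFlip {X : Finset (ℝ × ℝ)} {col : ℝ × ℝ → Fin 4}
    (h : FinBlocked X col) (γ : Fin 4) : NoDoubleFlip (X.filter fun p => col p = γ) := by
  intro a ha b hb c hc d hd e he h₁ h₂ h₁e h₂e
  obtain ⟨x, hx, -, -, q, hq, -, -, s, hs, -, hx_ed, -, hq_ec, -, -, -, hqxs⟩ :=
    h.empty_quad ha he hc hd h₁ h₁e
  obtain ⟨y, hy, -, -, q', hq', -, -, s', hs', hy_ec, -, -, -, -, hs'_de, -, hqys⟩ :=
    h.empty_quad he hb hc hd h₂ h₂e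
  have hcX := (Finset.mem_filter.1 hc).1
  have hdX := (Finset.mem_filter.1 hd).1
  have heX := (Finset.mem_filter.1 he).1
  obtain rfl := h.blocker_unique heX hq hy hcX hq_ec hy_ec
  obtain rfl := h.blocker_unique heX hs' hx hdX hs'_de.symm hx_ed
  exact h.not_four_collinear hq' hq hs' hs hqys hqxs

/-! ### Point sets without double flips -/

theorem ConvexQuad.orient_nonneg_of_inQuad {a b c d r u v : ℝ × ℝ} (h : ConvexQuad a b c d)
    (hr : InQuad a b c d r) (ha : 0 ≤ orient u v a) (hb : 0 ≤ orient u v b)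
    (hc : 0 ≤ orient u v c) (hd : 0 ≤ orient u v d) : 0 ≤ orient u v r := by
  rcases le_total 0 (orient a c r) with hac | hac
  · have hpos : 0 < orient a c d := by rw [orient_rotate d a c, orient_rotate c d a]; exact h.cda
    refine nonneg_of_mul_nonneg_left ?_ hpos
    rw [orient_barycentric]
    exact add_nonneg (add_nonneg (mul_nonneg hr.cd ha) (mul_nonneg hr.da hc)) (mul_nonneg hac hd)
  · have hca : 0 ≤ orient c a r := by rw [orient_swap]; linarith
    refine nonneg_of_mul_nonneg_left ?_ h.abc
    rw [orient_barycentric]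
    exact add_nonneg (add_nonneg (mul_nonneg hr.bc ha) (mul_nonneg hca hb)) (mul_nonneg hr.ab hc)

/-- `W` is the set of points of `R` in the closed angle at `a` bounded by `f` and `l`. -/
structure IsWindow (R : Finset (ℝ × ℝ)) (a f l : ℝ × ℝ) (W : List (ℝ × ℝ)) : Prop where
  mem_or : ∀ r ∈ R, r ∈ W ∨ orient a f r < 0 ∨ orient l a r < 0
  mem : ∀ r ∈ W, r ∈ R
  nonneg_first : ∀ r ∈ W, 0 ≤ orient a f r
  nonneg_last : ∀ r ∈ W, 0 ≤ orient l a r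

theorem IsWindow.emptyQuad {R : Finset (ℝ × ℝ)} {a f l : ℝ × ℝ} {W : List (ℝ × ℝ)}
    (h : IsWindow R a f l W) {w x y z : ℝ × ℝ} (hq : ConvexQuad w x y z)
    (hw : w ∈ W) (hx : x ∈ W) (hy : y ∈ W) (hz : z ∈ W)
    (hW : ∀ r ∈ W, InQuad w x y z r → r = w ∨ r = x ∨ r = y ∨ r = z) :
    EmptyQuad R w x y z := by
  intro r hr hin
  rcases h.mem_or r hr with hr | hr | hr
  · exact hW r hr hin
  · exact absurd (hq.orient_nonneg_of_inQuad hin (h.nonneg_first w hw) (h.nonneg_first x hx)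
      (h.nonneg_first y hy) (h.nonneg_first z hz)) hr.not_ge
  · exact absurd (hq.orient_nonneg_of_inQuad hin (h.nonneg_last w hw) (h.nonneg_last x hx)
      (h.nonneg_last y hy) (h.nonneg_last z hz)) hr.not_ge

/-- In a window the emptiness of the quadrilaterals of a double flip only needs to be checked for
points of the window. -/
theorem IsWindow.false_of_doubleFlip {R : Finset (ℝ × ℝ)} (hR : NoDoubleFlip R)
    {x f l : ℝ × ℝ} {W : List (ℝ × ℝ)} (h : IsWindow R x f l W) (a b c d e : ℝ × ℝ)
    (ha : a ∈ W) (hb : b ∈ W) (hc : c ∈ W) (hd : d ∈ W) (he : e ∈ W)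
    (hW : ∀ r ∈ W, r = a ∨ r = b ∨ r = c ∨ r = d ∨ r = e ∨
      ¬ InQuad a e c d r ∧ ¬ InQuad e b c d r)
    (q₁ : ConvexQuad a e c d) (q₂ : ConvexQuad e b c d)
    (hb' : ¬ InQuad a e c d b) (ha' : ¬ InQuad e b c d a) : False := by
  refine hR a (h.mem a ha) b (h.mem b hb) c (h.mem c hc) d (h.mem d hd) e (h.mem e he) q₁ q₂
    (h.emptyQuad q₁ ha he hc hd fun r hr hin => ?_) (h.emptyQuad q₂ he hb hc hd fun r hr hin => ?_)
  · rcases hW r hr with rfl | rfl | rfl | rfl | rfl | hr' <;> tauto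
  · rcases hW r hr with rfl | rfl | rfl | rfl | rfl | hr' <;> tauto

theorem orient_mul_middle_left (a i j k l : ℝ × ℝ) :
    orient i j l * orient a j k = orient i j k * orient a j l + orient j k l * orient a i j := by
  simp only [orient]; ring

theorem orient_mul_middle_right (a i j k l : ℝ × ℝ) :
    orient i k l * orient a j k = orient j k l * orient a i k + orient i j k * orient a k l := by
  simp only [orient]; ring

theorem orient_mul_first (a i j k l : ℝ × ℝ) :
    orient i j l * orient a i k = orient i k l * orient a i j + orient i j k * orient a i l := by
  simp only [orient]; ring

/-- The points of `W` belong to `R` and are sorted by angle around the point `a` of `R`. -/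
structure IsFan (R : Finset (ℝ × ℝ)) (a : ℝ × ℝ) (W : List (ℝ × ℝ)) : Prop where
  apex_mem : a ∈ R
  mem : ∀ p ∈ W, p ∈ R
  pairwise : W.Pairwise fun p q => 0 < orient a p q

/-- No three distinct points of `R` are collinear. -/
def GeneralPosition (R : Finset (ℝ × ℝ)) : Prop :=
  ∀ u ∈ R, ∀ v ∈ R, ∀ w ∈ R, u ≠ v → v ≠ w → w ≠ u → orient u v w ≠ 0

theorem pos_of_mul_eq_add {x y p q r s : ℝ} (h : x * y = p * q + r * s) (hy : 0 < y)
    (hp : 0 < p) (hq : 0 < q) (hr : 0 < r) (hs : 0 < s) : 0 < x :=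
  pos_of_mul_pos_left (h ▸ add_pos (mul_pos hp hq) (mul_pos hr hs)) hy.le

theorem neg_of_mul_eq_add {x y p q r s : ℝ} (h : x * y = p * q + r * s) (hy : 0 < y)
    (hp : p < 0) (hq : 0 < q) (hr : r < 0) (hs : 0 < s) : x < 0 :=
  neg_of_mul_neg_left (h ▸ add_neg (mul_neg_of_neg_of_pos hp hq) (mul_neg_of_neg_of_pos hr hs))
    hy.le

theorem ne_of_orient_pos {a p q : ℝ × ℝ} (h : 0 < orient a p q) : p ≠ q := by
  rintro rfl
  simp at h

/-- The turns within four angularly consecutive points of `R`. -/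
theorem IsFan.orient_neg {R : Finset (ℝ × ℝ)} (hgp : GeneralPosition R)
    (hR : NoDoubleFlip R) {a b c d e : ℝ × ℝ} (hf : IsFan R a [b, c, d, e])
    (hw : IsWindow R a b e [a, b, c, d, e]) : orient b c e < 0 ∧ orient b d e < 0 := by
  obtain ⟨ha, hm, hp⟩ := hf
  simp only [List.mem_cons, List.not_mem_nil, or_false, forall_eq_or_imp, forall_eq,
    List.pairwise_cons, List.Pairwise.nil, and_true, IsEmpty.forall_iff, implies_true] at hm hp
  obtain ⟨hb, hc, hd, he⟩ := hm
  obtain ⟨⟨bc, bd, be⟩, ⟨cd, ce⟩, de⟩ := hp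
  have nbcd : orient b c d ≠ 0 := hgp b hb c hc d hd (ne_of_orient_pos bc) (ne_of_orient_pos cd)
    (ne_of_orient_pos bd).symm
  have ncde : orient c d e ≠ 0 := hgp c hc d hd e he (ne_of_orient_pos cd) (ne_of_orient_pos de)
    (ne_of_orient_pos ce).symm
  have nbce : orient b c e ≠ 0 := hgp b hb c hc e he (ne_of_orient_pos bc) (ne_of_orient_pos ce)
    (ne_of_orient_pos be).symm
  have nbde : orient b d e ≠ 0 := hgp b hb d hd e he (ne_of_orient_pos bd) (ne_of_orient_pos de)
    (ne_of_orient_pos be).symm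
  have hflip := hw.false_of_doubleFlip hR
  have s₁ : 0 < orient b c d → 0 < orient b d e → False := fun h₁ h₂ => by
    refine hflip c e a b d (by simp) (by simp) (by simp) (by simp) (by simp) (by simp)
      ⟨?_, ?_, ?_, ?_⟩ ⟨?_, ?_, ?_, ?_⟩ (fun ⟨_, _, _, _⟩ => ?_) (fun ⟨_, _, _, _⟩ => ?_) <;>
    · simp only [orient] at *; linarith
  have s₂ : 0 < orient c d e → 0 < orient b c e → False := fun h₁ h₂ => by
    refine hflip b d e a c (by simp) (by simp) (by simp) (by simp) (by simp) (by simp)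
      ⟨?_, ?_, ?_, ?_⟩ ⟨?_, ?_, ?_, ?_⟩ (fun ⟨_, _, _, _⟩ => ?_) (fun ⟨_, _, _, _⟩ => ?_) <;>
    · simp only [orient] at *; linarith
  have s₃ : 0 < orient b c d → 0 < orient b c e → orient b d e < 0 → orient c d e < 0 → False :=
    fun h₁ h₂ h₃ h₄ => by
    refine hflip e a b c d (by simp) (by simp) (by simp) (by simp) (by simp) (by simp)
      ⟨?_, ?_, ?_, ?_⟩ ⟨?_, ?_, ?_, ?_⟩ (fun ⟨_, _, _, _⟩ => ?_) (fun ⟨_, _, _, _⟩ => ?_) <;>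
    · simp only [orient] at *; linarith
  have s₄ : orient b c d < 0 → orient b c e < 0 → 0 < orient b d e → 0 < orient c d e → False :=
    fun h₁ h₂ h₃ h₄ => by
    refine hflip a b d e c (by simp) (by simp) (by simp) (by simp) (by simp) (by simp)
      ⟨?_, ?_, ?_, ?_⟩ ⟨?_, ?_, ?_, ?_⟩ (fun ⟨_, _, _, _⟩ => ?_) (fun ⟨_, _, _, _⟩ => ?_) <;>
    · simp only [orient] at *; linarith
  have s₅ : orient b c d < 0 → orient c d e < 0 → orient b c e < 0 ∧ orient b d e < 0 :=
    fun h₁ h₂ => ⟨neg_of_mul_eq_add (orient_mul_middle_left a b c d e) cd h₁ ce h₂ bc,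
      neg_of_mul_eq_add (orient_mul_middle_right a b c d e) cd h₂ bd h₁ de⟩
  rcases nbcd.lt_or_gt with h₁ | h₁ <;> rcases ncde.lt_or_gt with h₂ | h₂
  · exact s₅ h₁ h₂
  all_goals grind

/-- The turns of consecutive triples within five angularly consecutive points of `R`. -/
theorem IsFan.orient_alternating {R : Finset (ℝ × ℝ)} (hgp : GeneralPosition R)
    (hR : NoDoubleFlip R) {a b c d e f : ℝ × ℝ} (hf : IsFan R a [b, c, d, e, f])
    (hw : IsWindow R a b f [a, b, c, d, e, f])
    (hw₁ : IsWindow R a b e [a, b, c, d, e]) (hw₂ : IsWindow R a c f [a, c, d, e, f]) :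
    0 < orient b c d ∧ orient c d e < 0 ∧ 0 < orient d e f := by
  have hf₁ : IsFan R a [b, c, d, e] := by
    refine ⟨hf.apex_mem, fun p hp => hf.mem p ?_, hf.pairwise.sublist ?_⟩
    · simp only [List.mem_cons, List.not_mem_nil, or_false] at hp ⊢; tauto
    · exact List.prefix_append [b, c, d, e] [f] |>.sublist
  have hf₂ : IsFan R a [c, d, e, f] :=
    ⟨hf.apex_mem, fun p hp => hf.mem p (List.mem_cons_of_mem _ hp), hf.pairwise.tail⟩
  obtain ⟨bce, bde⟩ := hf₁.orient_neg hgp hR hw₁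
  obtain ⟨cdf, cef⟩ := hf₂.orient_neg hgp hR hw₂
  obtain ⟨ha, hm, hp⟩ := hf
  simp only [List.mem_cons, List.not_mem_nil, or_false, forall_eq_or_imp, forall_eq,
    List.pairwise_cons, List.Pairwise.nil, and_true, IsEmpty.forall_iff, implies_true] at hm hp
  obtain ⟨hb, hc, hd, he, hf⟩ := hm
  obtain ⟨⟨bc, bd, be, bf⟩, ⟨cd, ce, cf⟩, ⟨de, df⟩, ef⟩ := hp
  have nbcd : orient b c d ≠ 0 := hgp b hb c hc d hd (ne_of_orient_pos bc) (ne_of_orient_pos cd)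
    (ne_of_orient_pos bd).symm
  have ncde : orient c d e ≠ 0 := hgp c hc d hd e he (ne_of_orient_pos cd) (ne_of_orient_pos de)
    (ne_of_orient_pos ce).symm
  have ndef : orient d e f ≠ 0 := hgp d hd e he f hf (ne_of_orient_pos de) (ne_of_orient_pos ef)
    (ne_of_orient_pos df).symm
  have bcf : orient b c f < 0 := neg_of_mul_eq_add (orient_mul_middle_left a b c e f) ce bce cf
    cef bc
  have bef : orient b e f < 0 := neg_of_mul_eq_add (orient_mul_middle_right a b c e f) ce cef be
    bce ef
  have bdf : orient b d f < 0 := neg_of_mul_eq_add (orient_mul_first a b d e f) be bef bd bde bf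
  have out : ∀ {w x y z r u v}, ConvexQuad w x y z → 0 ≤ orient u v w → 0 ≤ orient u v x →
      0 ≤ orient u v y → 0 ≤ orient u v z → orient u v r < 0 → ¬ InQuad w x y z r :=
    fun hq hw hx hy hz hr hin => (hq.orient_nonneg_of_inQuad hin hw hx hy hz).not_gt hr
  have hflip := hw.false_of_doubleFlip hR
  have s₁ : orient b c d < 0 → orient c d e < 0 → False := fun h₁ h₂ => by
    have q₁ : ConvexQuad f e c b := by
      constructor <;> simp only [orient] at * <;> linarith
    have q₂ : ConvexQuad e d c b := by
      constructor <;> simp only [orient] at * <;> linarith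
    refine hflip f d c b e (by simp) (by simp) (by simp) (by simp) (by simp) ?_ q₁ q₂
      (fun ⟨_, _, _, _⟩ => ?_) (out (u := e) (v := a) q₂ ?_ ?_ ?_ ?_ ?_)
    · have ha' : ¬ InQuad f e c b a ∧ ¬ InQuad e d c b a := by
        constructor <;> refine fun ⟨_, _, _, _⟩ => ?_ <;> simp only [orient] at * <;> linarith
      simp [ha']
    all_goals simp only [orient] at *; linarith
  have s₂ : orient c d e < 0 → orient d e f < 0 → False := fun h₁ h₂ => by
    have q₁ : ConvexQuad d c f e := by
      constructor <;> simp only [orient] at * <;> linarith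
    have q₂ : ConvexQuad c b f e := by
      constructor <;> simp only [orient] at * <;> linarith
    refine hflip d b f e c (by simp) (by simp) (by simp) (by simp) (by simp) ?_ q₁ q₂
      (out (u := a) (v := c) q₁ ?_ ?_ ?_ ?_ ?_) (fun ⟨_, _, _, _⟩ => ?_)
    · have ha' : ¬ InQuad d c f e a ∧ ¬ InQuad c b f e a := by
        constructor <;> refine fun ⟨_, _, _, _⟩ => ?_ <;> simp only [orient] at * <;> linarith
      simp [ha']
    all_goals simp only [orient] at *; linarith
  have s₃ : orient b c d < 0 → orient d e f < 0 → False := fun h₁ h₂ => by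
    have q₁ : ConvexQuad e d b f := by
      constructor <;> simp only [orient] at * <;> linarith
    have q₂ : ConvexQuad d c b f := by
      constructor <;> simp only [orient] at * <;> linarith
    refine hflip e c b f d (by simp) (by simp) (by simp) (by simp) (by simp) ?_ q₁ q₂
      (fun ⟨_, _, _, _⟩ => ?_) (fun ⟨_, _, _, _⟩ => ?_)
    · have ha' : ¬ InQuad e d b f a ∧ ¬ InQuad d c b f a := by
        constructor <;> refine fun ⟨_, _, _, _⟩ => ?_ <;> simp only [orient] at * <;> linarith
      simp [ha']
    all_goals simp only [orient] at *; linarith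
  have s₄ : 0 < orient b c d → 0 < orient c d e → False := fun h₁ h₂ =>
    (pos_of_mul_eq_add (orient_mul_middle_left a b c d e) cd h₁ ce h₂ bc).not_gt bce
  have s₅ : 0 < orient c d e → 0 < orient d e f → False := fun h₁ h₂ =>
    (pos_of_mul_eq_add (orient_mul_middle_left a c d e f) de h₁ df h₂ cd).not_gt cdf
  grind

theorem fst_lt_of_orient_pos {a p q : ℝ × ℝ} (hp : toLex a < toLex p) (hq : toLex a < toLex q)
    (h : 0 < orient a p q) : a.1 < p.1 := by
  rcases Prod.Lex.toLex_lt_toLex.1 hp with h₁ | ⟨h₁, h₂⟩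
  · exact h₁
  · have hq' : a.1 ≤ q.1 := (Prod.Lex.toLex_lt_toLex.1 hq).elim le_of_lt fun h => h.1.le
    simp only [orient, ← h₁, sub_self, zero_mul, zero_sub] at h
    nlinarith

theorem orient_pos_trans {a p q r : ℝ × ℝ} (hp : toLex a < toLex p) (hq : toLex a < toLex q)
    (hr : toLex a < toLex r) (hpq : 0 < orient a p q) (hqr : 0 < orient a q r) :
    0 < orient a p r := by
  have hp' := fst_lt_of_orient_pos hp hq hpq
  have hq' := fst_lt_of_orient_pos hq hr hqr
  have hr' : a.1 ≤ r.1 := (Prod.Lex.toLex_lt_toLex.1 hr).elim le_of_lt fun h => h.1.le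
  have e : orient a p r * (q.1 - a.1)
      = orient a p q * (r.1 - a.1) + orient a q r * (p.1 - a.1) := by
    simp only [orient]; ring
  refine pos_of_mul_pos_left (b := q.1 - a.1) ?_ (by linarith)
  rw [e]
  exact add_pos_of_nonneg_of_pos (mul_nonneg hpq.le (by linarith)) (mul_pos hqr (by linarith))

theorem exists_angular_min {a : ℝ × ℝ} {S : Finset (ℝ × ℝ)} (hS : ∀ p ∈ S, toLex a < toLex p)
    (hgp : ∀ p ∈ S, ∀ q ∈ S, p ≠ q → orient a p q ≠ 0) (hne : S.Nonempty) :
    ∃ m ∈ S, ∀ q ∈ S, q ≠ m → 0 < orient a m q := by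
  classical
  induction hne using Finset.Nonempty.cons_induction with
  | singleton p => exact ⟨p, by simp, by simp⟩
  | cons p T hp hT ih =>
    obtain ⟨m, hm, hmin⟩ := ih (fun q hq => hS q (Finset.mem_cons_of_mem hq))
      fun q hq r hr => hgp q (Finset.mem_cons_of_mem hq) r (Finset.mem_cons_of_mem hr)
    have hpS : p ∈ T.cons p hp := Finset.mem_cons_self p T
    have hmS : m ∈ T.cons p hp := Finset.mem_cons_of_mem hm
    have hmp : m ≠ p := by rintro rfl; exact hp hm
    rcases (hgp m hmS p hpS hmp).lt_or_gt with h | h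
    · have h' : 0 < orient a p m := by
        simp only [orient] at h ⊢; linarith
      refine ⟨p, hpS, fun q hq hqp => ?_⟩
      have hqT := (Finset.mem_cons.1 hq).resolve_left hqp
      by_cases hqm : q = m
      · exact hqm ▸ h'
      · exact orient_pos_trans (hS p hpS) (hS m hmS) (hS q hq) h' (hmin q hqT hqm)
    · refine ⟨m, hmS, fun q hq hqm => ?_⟩
      rcases Finset.mem_cons.1 hq with rfl | hq
      · exact h
      · exact hmin q hq hqm

/-- Points in a half-plane bounded by a line through `a` can be sorted by angle around `a`. -/
theorem exists_sorted_list {a : ℝ × ℝ} (S : Finset (ℝ × ℝ)) (hS : ∀ p ∈ S, toLex a < toLex p)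
    (hgp : ∀ p ∈ S, ∀ q ∈ S, p ≠ q → orient a p q ≠ 0) :
    ∃ L : List (ℝ × ℝ), L.length = S.card ∧ (∀ p, p ∈ L ↔ p ∈ S) ∧
      L.Pairwise fun p q => 0 < orient a p q := by
  classical
  induction S using Finset.strongInduction with
  | H S ih =>
    rcases S.eq_empty_or_nonempty with rfl | hne
    · exact ⟨[], by simp⟩
    obtain ⟨m, hm, hmin⟩ := exists_angular_min hS hgp hne
    obtain ⟨L, hL, hmem, hpw⟩ := ih (S.erase m) (Finset.erase_ssubset hm)
      (fun p hp => hS p (Finset.mem_of_mem_erase hp)) fun p hp q hq =>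
        hgp p (Finset.mem_of_mem_erase hp) q (Finset.mem_of_mem_erase hq)
    refine ⟨m :: L, ?_, fun p => ?_, List.pairwise_cons.2 ⟨fun q hq => ?_, hpw⟩⟩
    · rw [List.length_cons, hL, Finset.card_erase_add_one hm]
    · rw [List.mem_cons, hmem, Finset.mem_erase]
      by_cases hpm : p = m
      · simp [hpm, hm]
      · simp [hpm]
    · obtain ⟨hqm, hq⟩ := Finset.mem_erase.1 ((hmem q).1 hq)
      exact hmin q hq hqm

/-- A block `W` of an angularly sorted enumeration of the points of `R` other than `a`. -/
theorem IsFan.isWindow_of_append {R : Finset (ℝ × ℝ)} {a f l : ℝ × ℝ} {P W Q : List (ℝ × ℝ)}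
    (h : IsFan R a (P ++ (W ++ Q))) (hR : ∀ r ∈ R, r = a ∨ r ∈ P ++ (W ++ Q)) (hf : f ∈ W)
    (hl : l ∈ W) (hfW : ∀ p ∈ W, p = f ∨ 0 < orient a f p)
    (hlW : ∀ p ∈ W, p = l ∨ 0 < orient a p l) : IsWindow R a f l (a :: W) := by
  obtain ⟨ha, hm, hp⟩ := h
  rw [List.pairwise_append, List.pairwise_append] at hp
  obtain ⟨-, ⟨-, -, hWQ⟩, hPW⟩ := hp
  refine ⟨fun r hr => ?_, fun r hr => ?_, fun r hr => ?_, fun r hr => ?_⟩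
  · rcases hR r hr with rfl | hr
    · simp
    rcases List.mem_append.1 hr with hr | hr
    · have := hPW r hr f (List.mem_append_left _ hf)
      refine Or.inr (Or.inl ?_)
      simp only [orient] at *; linarith
    rcases List.mem_append.1 hr with hr | hr
    · exact Or.inl (List.mem_cons_of_mem a hr)
    · have := hWQ l hl r hr
      refine Or.inr (Or.inr ?_)
      rw [orient_swap]; linarith
  · rcases List.mem_cons.1 hr with rfl | hr
    · exact ha
    · exact hm r (by simp [hr])
  · rcases List.mem_cons.1 hr with rfl | hr
    · simp
    · rcases hfW r hr with rfl | h
      · simp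
      · exact h.le
  · rcases List.mem_cons.1 hr with rfl | hr
    · simp
    · rcases hlW r hr with rfl | h
      · simp
      · rw [orient_rotate r l a, orient_rotate a r l]; exact h.le

/-- A planar set in general position without double flips has at most six points. -/
theorem card_le_six_of_noDoubleFlip {R : Finset (ℝ × ℝ)} (hgp : GeneralPosition R)
    (hR : NoDoubleFlip R) : R.card ≤ 6 := by
  classical
  by_contra! hlt
  obtain ⟨a, ha, hmin⟩ := R.exists_min_image toLex (Finset.card_pos.1 (by omega))
  obtain ⟨L, hL, hmem, hpw⟩ := exists_sorted_list (a := a) (R.erase a)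
    (fun p hp => (hmin p (Finset.mem_of_mem_erase hp)).lt_of_ne fun h =>
      Finset.ne_of_mem_erase hp (toLex.injective h).symm)
    fun p hp q hq hpq => hgp a ha p (Finset.mem_of_mem_erase hp) q (Finset.mem_of_mem_erase hq)
      (Finset.ne_of_mem_erase hp).symm hpq (Finset.ne_of_mem_erase hq)
  rw [Finset.card_erase_of_mem ha] at hL
  obtain ⟨b, c, d, e, f, g, M, rfl⟩ : ∃ b c d e f g M, L = b :: c :: d :: e :: f :: g :: M := by
    match L, hL with
    | b :: c :: d :: e :: f :: g :: M, _ => exact ⟨b, c, d, e, f, g, M, rfl⟩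
    | [], h | [_], h | [_, _], h | [_, _, _], h | [_, _, _, _], h | [_, _, _, _, _], h =>
      simp at h; omega
  have hmemR : ∀ r ∈ R, r = a ∨ r ∈ b :: c :: d :: e :: f :: g :: M := fun r hr =>
    or_iff_not_imp_left.2 fun h => (hmem r).2 (Finset.mem_erase.2 ⟨h, hr⟩)
  have fan : ∀ W : List (ℝ × ℝ), W.Sublist (b :: c :: d :: e :: f :: g :: M) → IsFan R a W :=
    fun W hW => ⟨ha, fun p hp => Finset.mem_of_mem_erase ((hmem p).1 (hW.subset hp)),
      hpw.sublist hW⟩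
  have hL := fan _ (List.Sublist.refl _)
  have w₁ : IsWindow R a b e [a, b, c, d, e] :=
    IsFan.isWindow_of_append (P := []) (Q := f :: g :: M) hL hmemR (by simp) (by simp)
      (by simp_all) (by simp_all)
  have w₂ : IsWindow R a c f [a, c, d, e, f] :=
    IsFan.isWindow_of_append (P := [b]) (Q := g :: M) hL hmemR (by simp) (by simp)
      (by simp_all) (by simp_all)
  have w₃ : IsWindow R a d g [a, d, e, f, g] :=
    IsFan.isWindow_of_append (P := [b, c]) (Q := M) hL hmemR (by simp) (by simp)
      (by simp_all) (by simp_all)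
  have w₄ : IsWindow R a b f [a, b, c, d, e, f] :=
    IsFan.isWindow_of_append (P := []) (Q := g :: M) hL hmemR (by simp) (by simp)
      (by simp_all) (by simp_all)
  have w₅ : IsWindow R a c g [a, c, d, e, f, g] :=
    IsFan.isWindow_of_append (P := [b]) (Q := M) hL hmemR (by simp) (by simp)
      (by simp_all) (by simp_all)
  have h₁ := (fan [b, c, d, e, f] (List.prefix_append _ (g :: M)).sublist).orient_alternating
    hgp hR w₄ w₁ w₂
  have h₂ := (fan [c, d, e, f, g] ((List.prefix_append _ M).sublist.cons b)).orient_alternating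
    hgp hR w₅ w₂ w₃
  exact h₁.2.1.not_gt h₂.1

theorem BlockedColouring.finBlocked {k : ℕ} {P : Set (ℝ × ℝ)} {c : ℝ × ℝ → Fin k}
    (h : BlockedColouring P c) (hP : P.Finite) : FinBlocked hP.toFinset c := by
  intro v hv w hw hne
  rw [← not_iff_not, ← ne_eq, ← h v (hP.mem_toFinset.1 hv) w (hP.mem_toFinset.1 hw) hne]
  simp [Visible, Blocks, sbtw_iff_mem_image_Ioo_and_ne, hne, openSegment_eq_image_lineMap]

/-- Every 4-blocked point set has at most 36 points. -/
theorem four_blocked_le_36 (P : Set (ℝ × ℝ)) (hP : KBlocked 4 P) :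
    P.ncard ≤ 36 := by
  obtain ⟨hfin, c, hc⟩ := hP
  have h := hc.finBlocked hfin
  rw [Set.ncard_eq_toFinset_card P hfin]
  have hcls : ∀ γ : Fin 4, (hfin.toFinset.filter fun p => c p = γ).card ≤ 6 := fun γ =>
    card_le_six_of_noDoubleFlip (fun u hu v hv w hw huv hvw hwu => by
      rw [Finset.mem_filter] at hu hv hw
      exact h.orient_ne_zero hu.1 hv.1 hw.1 huv hvw hwu (hu.2.trans hv.2.symm)
        (hv.2.trans hw.2.symm)) (h.noDoubleFlip γ)
  have h₁ := Finset.card_le_mul_card_image (f := c) hfin.toFinset 6 fun γ _ => hcls γ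
  have h₂ := Finset.card_le_univ (hfin.toFinset.image c)
  rw [Fintype.card_fin] at h₂
  omega
end
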